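/- arXiv:1206.1950 — 4 statements merged into one kernel-verified Lean document; each statement's English description precedes it below -/
import Mathlib

section
/- Assume β_k > 0 for all k ≥ 1, and that P_k(1) > 0 and P^{(m)}_k(1) > 0 for all k ≥ 0, where m ≥ 1. Let L_m := lim_{n→∞} P_n(1)/(P^{(m)}_{n−m}(1)·P_m(1)) (this limit exists and lies in [0,1)). Then for every λ ∈ ℝ: P*_n(1, λ, m) > 0 holds for all n ≥ 0 if and only if λ ≤ 1/(1−L_m). Moreover, if λ > 1/(1−L_m), then there exist an integer n ≥ 1 and a real number x > 1 with P*_n(x, λ, m) = 0. -/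
open Polynomial Filter

noncomputable section

/-- Monic polynomials `P_0 = 1`, `P_1 = X`, `P_{k+1} = X·P_k − β_k·P_{k−1}` (`k ≥ 1`). -/
def recP (β : ℕ → ℝ) : ℕ → Polynomial ℝ
  | 0 => 1
  | 1 => X
  | (k + 2) => X * recP β (k + 1) - C (β (k + 1)) * recP β k

/-- Co-dilated polynomials: same recurrence as `recP β`, except that at index `k = m`
the coefficient `β_m` is replaced by `λ·β_m`. -/
def recPstar (β : ℕ → ℝ) (lam : ℝ) (m : ℕ) : ℕ → Polynomial ℝ
  | 0 => 1
  | 1 => X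
  | (k + 2) => X * recPstar β lam m (k + 1) -
      C (if k + 1 = m then lam * β (k + 1) else β (k + 1)) * recPstar β lam m k

/-- The `m`-th numerator polynomials: `P^{(m)}_0 = 1`, `P^{(m)}_1 = X`,
`P^{(m)}_{k+1} = X·P^{(m)}_k − β_{k+m}·P^{(m)}_{k−1}` (`k ≥ 1`). -/
def recPnum (β : ℕ → ℝ) (m : ℕ) : ℕ → Polynomial ℝ
  | 0 => 1
  | 1 => X
  | (k + 2) => X * recPnum β m (k + 1) - C (β (k + 1 + m)) * recPnum β m k


/-- The sequence `a_n = P_n(1)/(P^{(m)}_{n−m}(1)·P_m(1))` (for `n ≥ m`). -/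
def aSeq (β : ℕ → ℝ) (m : ℕ) (n : ℕ) : ℝ :=
  (recP β n).eval 1 / ((recPnum β m (n - m)).eval 1 * (recP β m).eval 1)

/-- The co-dilated polynomials agree with the original ones up to index `m`. -/
theorem recPstar_eq_recP_of_le (β : ℕ → ℝ) (lam : ℝ) (m n : ℕ) (hn : n ≤ m) :
    recPstar β lam m n = recP β n := by
  induction n using Nat.twoStepInduction with
  | zero => rfl
  | one => rfl
  | more k ih₀ ih₁ =>
    rw [recPstar, recP, ih₀ (by omega), ih₁ (by omega), if_neg (by omega)]

/-- Beyond index `m`, the co-dilated polynomials are a combination of the original polynomials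
and the numerator polynomials. -/
theorem recPstar_add_eq (β : ℕ → ℝ) (lam : ℝ) (m k : ℕ) (hm : 1 ≤ m) :
    recPstar β lam m (m + k) =
      C lam * recP β (m + k) + C (1 - lam) * recP β m * recPnum β m k := by
  obtain ⟨j, rfl⟩ := Nat.exists_eq_add_of_le' hm
  induction k using Nat.twoStepInduction with
  | zero =>
    simp only [add_zero, recPnum, recPstar_eq_recP_of_le β lam (j + 1) (j + 1) le_rfl, C_sub, C_1]
    ring
  | one =>
    rw [recPstar, recP, recPnum, recPstar_eq_recP_of_le β lam (j + 1) (j + 1) le_rfl,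
      recPstar_eq_recP_of_le β lam (j + 1) j (by omega), if_pos rfl]
    simp only [C_sub, C_1, C_mul]
    ring
  | more k ih₀ ih₁ =>
    have hβ : β (k + 1 + (j + 1)) = β (j + 1 + k + 1) := by congr 1; omega
    rw [← add_assoc (j + 1) k 2, recPstar, recP, recPnum, if_neg (by omega), hβ, add_assoc _ k 1,
      ih₀, ih₁]
    ring

/-- Positivity of the Casoratian of the original and the numerator polynomials at `1`. -/
theorem recP_mul_recPnum_lt (β : ℕ → ℝ) (hβ : ∀ k, 1 ≤ k → 0 < β k) (m : ℕ) (hm : 1 ≤ m)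
    (hP : ∀ k : ℕ, 0 < (recP β k).eval 1) (k : ℕ) :
    (recP β (m + (k + 1))).eval 1 * (recPnum β m k).eval 1 <
      (recP β (m + k)).eval 1 * (recPnum β m (k + 1)).eval 1 := by
  obtain ⟨j, rfl⟩ := Nat.exists_eq_add_of_le' hm
  induction k with
  | zero =>
    simpa [recP, recPnum] using mul_pos (hβ (j + 1) (by omega)) (hP j)
  | succ k ih =>
    have hβ' : β (k + 1 + (j + 1)) = β (j + 1 + k + 1) := by congr 1; omega
    have hpos := hβ (j + 1 + k + 1) (by omega)
    have h := mul_lt_mul_of_pos_left ih hpos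
    have hrec : (recP β (j + 1 + (k + 1 + 1))).eval 1 =
        (recP β (j + 1 + (k + 1))).eval 1 - β (j + 1 + k + 1) * (recP β (j + 1 + k)).eval 1 := by
      rw [show j + 1 + (k + 1 + 1) = (j + 1 + k) + 2 by omega, recP]
      simp [add_assoc]
    rw [hrec, recPnum, hβ']
    simp only [eval_sub, eval_mul, eval_X, eval_C]
    linarith

/-- At each index, the co-dilated polynomials are eventually positive. -/
theorem eventually_recPstar_pos (β : ℕ → ℝ) (lam : ℝ) (m n : ℕ) :
    ∀ᶠ x in atTop, 0 < (recPstar β lam m n).eval x := by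
  suffices h : ∀ᶠ x in atTop, 0 < (recPstar β lam m n).eval x ∧
      (recPstar β lam m n).eval x ≤ (recPstar β lam m (n + 1)).eval x from h.mono fun _ hx ↦ hx.1
  induction n with
  | zero =>
    filter_upwards [eventually_ge_atTop 1] with x hx
    simpa [recPstar] using hx
  | succ k ih =>
    rw [recPstar]
    generalize (if k + 1 = m then lam * β (k + 1) else β (k + 1)) = c
    filter_upwards [ih, eventually_ge_atTop (1 + |c|)] with x ⟨hpos, hle⟩ hx
    have hpos' := hpos.trans_le hle
    refine ⟨hpos', ?_⟩
    simp only [eval_sub, eval_mul, eval_X, eval_C]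
    have h₁ := mul_le_mul_of_nonneg_right (le_abs_self c) hpos.le
    have h₂ := mul_le_mul_of_nonneg_left hle (abs_nonneg c)
    have h₃ := mul_le_mul_of_nonneg_right hx hpos'.le
    linarith

/-- A co-dilated polynomial negative at `1` has positive index and a zero beyond `1`. -/
theorem exists_one_lt_recPstar_eval_eq_zero (β : ℕ → ℝ) (lam : ℝ) (m n : ℕ)
    (hneg : (recPstar β lam m n).eval 1 < 0) :
    1 ≤ n ∧ ∃ x : ℝ, 1 < x ∧ (recPstar β lam m n).eval x = 0 := by
  refine ⟨Nat.one_le_iff_ne_zero.2 ?_, ?_⟩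
  · rintro rfl
    norm_num [recPstar] at hneg
  · obtain ⟨y, hy, hy1⟩ :=
      ((eventually_recPstar_pos β lam m n).and (eventually_gt_atTop 1)).exists
    obtain ⟨x, hx, hx0⟩ :=
      intermediate_value_Ioo hy1.le (recPstar β lam m n).continuous.continuousOn ⟨hneg, hy⟩
    exact ⟨x, hx.1, hx0⟩

theorem codilated_zeros_in_interval (β : ℕ → ℝ) (hβ : ∀ k, 1 ≤ k → 0 < β k)
    (m : ℕ) (hm : 1 ≤ m)
    (hP : ∀ k : ℕ, 0 < (recP β k).eval 1) (hQ : ∀ k : ℕ, 0 < (recPnum β m k).eval 1)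
    (L : ℝ) (hL : Tendsto (aSeq β m) atTop (nhds L)) (hL0 : 0 ≤ L) (hL1 : L < 1)
    (lam : ℝ) :
    ((∀ n : ℕ, 0 < (recPstar β lam m n).eval 1) ↔ lam ≤ 1 / (1 - L)) ∧
    (1 / (1 - L) < lam →
      ∃ n : ℕ, 1 ≤ n ∧ ∃ x : ℝ, 1 < x ∧ (recPstar β lam m n).eval x = 0) := by
  have hden (k : ℕ) : 0 < (recPnum β m k).eval 1 * (recP β m).eval 1 := mul_pos (hQ k) (hP m)
  have hstar (k : ℕ) : (recPstar β lam m (m + k)).eval 1 =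
      ((recPnum β m k).eval 1 * (recP β m).eval 1) * (1 - lam * (1 - aSeq β m (m + k))) := by
    have hQk := (hQ k).ne'
    have hPm := (hP m).ne'
    rw [recPstar_add_eq β lam m k hm, aSeq, Nat.add_sub_cancel_left]
    simp only [eval_add, eval_mul, eval_C]
    field_simp
    ring
  have hanti : StrictAnti fun k ↦ aSeq β m (m + k) := by
    refine strictAnti_nat_of_succ_lt fun k ↦ ?_
    simp only [aSeq, Nat.add_sub_cancel_left]
    rw [div_lt_div_iff₀ (hden _) (hden _)]
    have h := mul_lt_mul_of_pos_right (recP_mul_recPnum_lt β hβ m hm hP k) (hP m)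
    linarith
  have hlim : Tendsto (fun k ↦ aSeq β m (m + k)) atTop (nhds L) := by
    simpa only [add_comm m] using (tendsto_add_atTop_iff_nat m).2 hL
  have hgt (k : ℕ) : L < aSeq β m (m + k) :=
    (hanti.antitone.le_of_tendsto hlim (k + 1)).trans_lt (hanti k.lt_succ_self)
  have hle (k : ℕ) : aSeq β m (m + k) ≤ 1 := by
    refine (hanti.antitone k.zero_le).trans_eq ?_
    simp [aSeq, recPnum, (hP m).ne']
  have hL' : 0 < 1 - L := sub_pos.2 hL1
  have hneg (h : 1 / (1 - L) < lam) : ∃ n, (recPstar β lam m n).eval 1 < 0 := by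
    have hlim' : Tendsto (fun k ↦ 1 - lam * (1 - aSeq β m (m + k))) atTop
        (nhds (1 - lam * (1 - L))) :=
      ((hlim.const_sub 1).const_mul lam).const_sub 1
    rw [div_lt_iff₀ hL'] at h
    obtain ⟨k, hk⟩ := (hlim'.eventually_lt_const (sub_neg.2 h)).exists
    exact ⟨m + k, hstar k ▸ mul_neg_of_pos_of_neg (hden k) hk⟩
  refine ⟨⟨fun h ↦ ?_, fun h n ↦ ?_⟩, fun h ↦ ?_⟩
  · by_contra! hlam
    obtain ⟨n, hn⟩ := hneg hlam
    exact (h n).not_gt hn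
  · rcases le_total n m with hn | hn
    · rw [recPstar_eq_recP_of_le β lam m n hn]
      exact hP n
    · obtain ⟨k, rfl⟩ := Nat.exists_eq_add_of_le hn
      rw [hstar k]
      refine mul_pos (hden k) (sub_pos.2 ?_)
      rw [le_div_iff₀ hL'] at h
      rcases le_or_gt lam 0 with hlam | hlam
      · exact (mul_nonpos_of_nonpos_of_nonneg hlam (sub_nonneg.2 (hle k))).trans_lt one_pos
      · exact (mul_lt_mul_of_pos_left (sub_lt_sub_left (hgt k) 1) hlam).trans_le h
  · obtain ⟨n, hn⟩ := hneg h
    exact ⟨n, exists_one_lt_recPstar_eval_eq_zero β lam m n hn⟩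

end
end

section
/- Let ν > 1/2. Define for x ∈ (−1,1): w_ν(x) = (1−x²)^{ν−1/2}, q_ν(x) = 2ν·(1−x²)^{ν−1/2}·∫₀ˣ (1−t²)^{−ν−1/2} dt, β₀ = 2^{2ν}Γ(ν+1/2)²/Γ(2ν+1), and Φ_ν(x) = 1/(q_ν(x)² + (π²/β₀²)·w_ν(x)²). Then there exist a real α ∈ (0,1], a constant C > 0, and a function Φ̄ : [−1,1] → ℝ such that Φ̄(x) = Φ_ν(x) for all x ∈ (−1,1), Φ̄(x) > 0 for all x ∈ [−1,1], and |Φ̄(x) − Φ̄(x′)| ≤ C·|x − x′|^α for all x, x′ ∈ [−1,1]; i.e. Φ_ν extends to a strictly positive Hölder-continuous function on [−1,1]. -/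
open MeasureTheory intervalIntegral

noncomputable section

/-- The ultraspherical weight `w_ν(x) = (1−x²)^{ν−1/2}`. -/
def wFun (ν x : ℝ) : ℝ := (1 - x ^ 2) ^ (ν - 1 / 2)

/-- `q_ν(x) = 2ν·(1−x²)^{ν−1/2}·∫₀ˣ (1−t²)^{−ν−1/2} dt`. -/
def qFun (ν x : ℝ) : ℝ :=
  2 * ν * (1 - x ^ 2) ^ (ν - 1 / 2) * ∫ t in (0 : ℝ)..x, (1 - t ^ 2) ^ (-ν - 1 / 2)

/-- `β₀ = 2^{2ν}·Γ(ν+1/2)²/Γ(2ν+1)`. -/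
def beta0 (ν : ℝ) : ℝ := 2 ^ (2 * ν) * Real.Gamma (ν + 1 / 2) ^ 2 / Real.Gamma (2 * ν + 1)

/-- `Φ_ν(x) = 1/(q_ν(x)² + (π²/β₀²)·w_ν(x)²)`. -/
def PhiFun (ν x : ℝ) : ℝ :=
  1 / (qFun ν x ^ 2 + Real.pi ^ 2 / beta0 ν ^ 2 * wFun ν x ^ 2)

theorem abs_sub_le_of_abs_deriv_le_rpow {f f' : ℝ → ℝ} {a K : ℝ} (ha : 0 < a) (ha1 : a ≤ 1)
    (hK : 0 ≤ K) (hf : ContinuousOn f (Set.Icc 0 1))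
    (hd : ∀ x ∈ Set.Ioo (0 : ℝ) 1, HasDerivAt f (f' x) x)
    (hb : ∀ x ∈ Set.Ioo (0 : ℝ) 1, |f' x| ≤ K * (1 - x) ^ (a - 1)) :
    ∀ x ∈ Set.Icc (0 : ℝ) 1, ∀ y ∈ Set.Icc (0 : ℝ) 1, |f x - f y| ≤ K / a * |x - y| ^ a := by
  have hcomp : ContinuousOn (fun x : ℝ => K / a * (1 - x) ^ a) (Set.Icc 0 1) := by
    refine ContinuousOn.mul continuousOn_const (ContinuousOn.rpow_const (by fun_prop) ?_)
    intro x _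
    exact Or.inr ha.le
  have hcompd : ∀ x ∈ Set.Ioo (0 : ℝ) 1,
      HasDerivAt (fun x : ℝ => K / a * (1 - x) ^ a) (-(K * (1 - x) ^ (a - 1))) x := by
    intro x hx
    have h1 : HasDerivAt (fun x : ℝ => 1 - x) (-1) x := by
      simpa using (hasDerivAt_id x).const_sub 1
    refine ((h1.rpow_const (p := a) (Or.inl (by linarith [hx.2]))).const_mul (K / a)).congr_deriv ?_
    field_simp
  have hanti : AntitoneOn (fun x => f x + K / a * (1 - x) ^ a) (Set.Icc 0 1) := by
    refine antitoneOn_of_hasDerivWithinAt_nonpos (convex_Icc 0 1) (hf.add hcomp)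
      (f' := fun x => f' x + -(K * (1 - x) ^ (a - 1))) ?_ ?_
    · intro x hx
      rw [interior_Icc] at hx
      exact ((hd x hx).add (hcompd x hx)).hasDerivWithinAt
    · intro x hx
      rw [interior_Icc] at hx
      have := (abs_le.1 (hb x hx)).2
      linarith
  have hmono : MonotoneOn (fun x => f x - K / a * (1 - x) ^ a) (Set.Icc 0 1) := by
    refine monotoneOn_of_hasDerivWithinAt_nonneg (convex_Icc 0 1) (hf.sub hcomp)
      (f' := fun x => f' x - -(K * (1 - x) ^ (a - 1))) ?_ ?_
    · intro x hx
      rw [interior_Icc] at hx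
      exact ((hd x hx).sub (hcompd x hx)).hasDerivWithinAt
    · intro x hx
      rw [interior_Icc] at hx
      have := (abs_le.1 (hb x hx)).1
      linarith
  have key : ∀ x ∈ Set.Icc (0 : ℝ) 1, ∀ y ∈ Set.Icc (0 : ℝ) 1, x ≤ y →
      |f x - f y| ≤ K / a * |x - y| ^ a := by
    intro x hx y hy hxy
    have h1 := hanti hx hy hxy
    have h2 := hmono hx hy hxy
    simp only at h1 h2
    have h3 : (1 - x) ^ a ≤ (1 - y) ^ a + (y - x) ^ a := by
      have := Real.rpow_add_le_add_rpow (p := a) (sub_nonneg.2 hy.2) (sub_nonneg.2 hxy) ha.le ha1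
      simpa using this
    have h4 : K / a * (1 - x) ^ a ≤ K / a * ((1 - y) ^ a + (y - x) ^ a) :=
      mul_le_mul_of_nonneg_left h3 (by positivity)
    rw [abs_sub_comm x y, abs_of_nonneg (sub_nonneg.2 hxy), abs_le]
    constructor <;> linarith
  intro x hx y hy
  rcases le_total x y with h | h
  · exact key x hx y hy h
  · rw [abs_sub_comm, abs_sub_comm x]
    exact key y hy x hx h

theorem one_sub_sq_pos {t : ℝ} (ht : t ∈ Set.Ioo (-1 : ℝ) 1) : 0 < 1 - t ^ 2 := by
  nlinarith [ht.1, ht.2]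

theorem uIcc_zero_subset_Ioo {x : ℝ} (hx : x ∈ Set.Ioo (-1 : ℝ) 1) :
    Set.uIcc 0 x ⊆ Set.Ioo (-1 : ℝ) 1 :=
  Set.ordConnected_Ioo.uIcc_subset (by norm_num) hx

theorem continuousOn_one_sub_sq_rpow (p : ℝ) :
    ContinuousOn (fun t : ℝ => (1 - t ^ 2) ^ p) (Set.Ioo (-1) 1) :=
  ContinuousOn.rpow_const (by fun_prop) fun _ ht => Or.inl (one_sub_sq_pos ht).ne'

theorem intervalIntegrable_one_sub_sq_rpow (p : ℝ) {x : ℝ} (hx : x ∈ Set.Ioo (-1 : ℝ) 1) :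
    IntervalIntegrable (fun t : ℝ => (1 - t ^ 2) ^ p) volume 0 x :=
  ((continuousOn_one_sub_sq_rpow p).mono (uIcc_zero_subset_Ioo hx)).intervalIntegrable

theorem hasDerivAt_one_sub_sq_rpow (p : ℝ) {x : ℝ} (hx : x ∈ Set.Ioo (-1 : ℝ) 1) :
    HasDerivAt (fun t : ℝ => (1 - t ^ 2) ^ p) (-(2 * p * x * (1 - x ^ 2) ^ (p - 1))) x := by
  have h1 : HasDerivAt (fun t : ℝ => 1 - t ^ 2) (-(2 * x)) x := by
    simpa using (hasDerivAt_pow 2 x).const_sub 1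
  refine (h1.rpow_const (p := p) (Or.inl (one_sub_sq_pos hx).ne')).congr_deriv ?_
  ring

theorem hasDerivAt_integral_one_sub_sq_rpow (p : ℝ) {x : ℝ} (hx : x ∈ Set.Ioo (-1 : ℝ) 1) :
    HasDerivAt (fun x : ℝ => ∫ t in (0 : ℝ)..x, (1 - t ^ 2) ^ p) ((1 - x ^ 2) ^ p) x :=
  integral_hasDerivAt_right (intervalIntegrable_one_sub_sq_rpow p hx)
    ((continuousOn_one_sub_sq_rpow p).stronglyMeasurableAtFilter isOpen_Ioo x hx)
    ((continuousOn_one_sub_sq_rpow p).continuousAt (isOpen_Ioo.mem_nhds hx))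

/-- Integration by parts lowers the order of the singularity at the end points by one. -/
theorem integral_one_sub_sq_rpow_reduction {μ : ℝ} (hμ : 0 < μ) {x : ℝ}
    (hx : x ∈ Set.Ioo (-1 : ℝ) 1) :
    ∫ t in (0 : ℝ)..x, (1 - t ^ 2) ^ (-μ - 1) =
      x * (1 - x ^ 2) ^ (-μ) / (2 * μ) +
        (1 - 1 / (2 * μ)) * ∫ t in (0 : ℝ)..x, (1 - t ^ 2) ^ (-μ) := by
  have hderiv : ∀ t ∈ Set.uIcc 0 x, HasDerivAt (fun t : ℝ => t * (1 - t ^ 2) ^ (-μ) / (2 * μ))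
      ((1 - t ^ 2) ^ (-μ - 1) - (1 - 1 / (2 * μ)) * (1 - t ^ 2) ^ (-μ)) t := by
    intro t ht
    have ht := uIcc_zero_subset_Ioo hx ht
    refine (((hasDerivAt_id t).mul
      (hasDerivAt_one_sub_sq_rpow (-μ) ht)).div_const (2 * μ)).congr_deriv ?_
    have h : (1 - t ^ 2) ^ (-μ) = (1 - t ^ 2) ^ (-μ - 1) * (1 - t ^ 2) := by
      rw [← Real.rpow_add_one (one_sub_sq_pos ht).ne']
      ring_nf
    simp only [id]
    rw [h]
    field_simp
    ring
  have hI := intervalIntegrable_one_sub_sq_rpow (-μ - 1) hx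
  have hJ := (intervalIntegrable_one_sub_sq_rpow (-μ) hx).const_mul (1 - 1 / (2 * μ))
  have h := integral_eq_sub_of_hasDerivAt hderiv (hI.sub hJ)
  rw [intervalIntegral.integral_sub hI hJ, intervalIntegral.integral_const_mul] at h
  simp only [zero_mul, zero_div, sub_zero] at h
  linarith

theorem integral_one_sub_rpow_neg_half_le {x : ℝ} (hx : x ∈ Set.Ico (0 : ℝ) 1) :
    IntervalIntegrable (fun t : ℝ => (1 - t) ^ (-(1 / 2) : ℝ)) volume 0 x ∧
    ∫ t in (0 : ℝ)..x, (1 - t) ^ (-(1 / 2) : ℝ) ≤ 2 := by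
  have hpos : ∀ t ∈ Set.uIcc 0 x, 0 < 1 - t := by
    intro t ht
    rw [Set.uIcc_of_le hx.1] at ht
    linarith [ht.2, hx.2]
  have hint : IntervalIntegrable (fun t : ℝ => (1 - t) ^ (-(1 / 2) : ℝ)) volume 0 x :=
    (ContinuousOn.rpow_const (by fun_prop) fun t ht => Or.inl (hpos t ht).ne').intervalIntegrable
  refine ⟨hint, ?_⟩
  have hderiv : ∀ t ∈ Set.uIcc 0 x, HasDerivAt (fun t : ℝ => -2 * (1 - t) ^ (1 / 2 : ℝ))
      ((1 - t) ^ (-(1 / 2) : ℝ)) t := by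
    intro t ht
    have h1 : HasDerivAt (fun x : ℝ => 1 - x) (-1) t := by
      simpa using (hasDerivAt_id t).const_sub 1
    refine ((h1.rpow_const (p := 1 / 2) (Or.inl (hpos t ht).ne')).const_mul (-2)).congr_deriv ?_
    norm_num
    ring
  rw [integral_eq_sub_of_hasDerivAt hderiv hint]
  have : 0 ≤ (1 - x) ^ (1 / 2 : ℝ) := Real.rpow_nonneg (by linarith [hx.2]) _
  norm_num
  norm_num at this
  linarith

/-- `(1−x²)^μ·∫₀ˣ (1−t²)^{−μ} dt`. -/
def weightedIntegral (μ x : ℝ) : ℝ :=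
  (1 - x ^ 2) ^ μ * ∫ t in (0 : ℝ)..x, (1 - t ^ 2) ^ (-μ)

theorem weightedIntegral_neg (μ x : ℝ) : weightedIntegral μ (-x) = -weightedIntegral μ x := by
  have h := intervalIntegral.integral_comp_neg (fun t : ℝ => (1 - t ^ 2) ^ (-μ)) (a := 0) (b := x)
  simp only [neg_sq, neg_zero] at h
  unfold weightedIntegral
  rw [h, intervalIntegral.integral_symm (-x) 0]
  ring_nf

theorem abs_weightedIntegral_le {μ a : ℝ} (ha2 : a ≤ 1 / 2) (haμ : a ≤ μ)
    {x : ℝ} (hx : x ∈ Set.Ico (0 : ℝ) 1) :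
    |weightedIntegral μ x| ≤ 2 * (1 - x ^ 2) ^ a := by
  have hx' : x ∈ Set.Ioo (-1 : ℝ) 1 := ⟨by linarith [hx.1], hx.2⟩
  have hs := one_sub_sq_pos hx'
  obtain ⟨hint, hle⟩ := integral_one_sub_rpow_neg_half_le hx
  have hJ0 : 0 ≤ ∫ t in (0 : ℝ)..x, (1 - t ^ 2) ^ (-μ) := by
    refine intervalIntegral.integral_nonneg hx.1 fun t ht => Real.rpow_nonneg ?_ _
    nlinarith [ht.1, ht.2, hx.2]
  have hJ : ∫ t in (0 : ℝ)..x, (1 - t ^ 2) ^ (-μ) ≤ (1 - x ^ 2) ^ (a - μ) * 2 := by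
    calc ∫ t in (0 : ℝ)..x, (1 - t ^ 2) ^ (-μ)
        ≤ ∫ t in (0 : ℝ)..x, (1 - x ^ 2) ^ (a - μ) * (1 - t) ^ (-(1 / 2) : ℝ) := by
          refine intervalIntegral.integral_mono_on hx.1
            (intervalIntegrable_one_sub_sq_rpow _ hx') (hint.const_mul _) fun t ht => ?_
          have ht1 : t < 1 := ht.2.trans_lt hx.2
          have htpos : 0 < 1 - t ^ 2 := by nlinarith [ht.1]
          have h1 : (1 - t ^ 2) ^ (-μ) = (1 - t ^ 2) ^ (a - μ) * (1 - t ^ 2) ^ (-a) := by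
            rw [← Real.rpow_add htpos]
            ring_nf
          rw [h1]
          refine mul_le_mul ?_ ?_ (by positivity) (by positivity)
          · exact Real.rpow_le_rpow_of_nonpos hs (by nlinarith [ht.1, ht.2]) (by linarith)
          · calc (1 - t ^ 2) ^ (-a) ≤ (1 - t ^ 2) ^ (-(1 / 2) : ℝ) :=
                  Real.rpow_le_rpow_of_exponent_ge htpos (by nlinarith) (by linarith)
              _ ≤ (1 - t) ^ (-(1 / 2) : ℝ) :=
                  Real.rpow_le_rpow_of_nonpos (by linarith) (by nlinarith [ht.1]) (by norm_num)
      _ = (1 - x ^ 2) ^ (a - μ) * ∫ t in (0 : ℝ)..x, (1 - t) ^ (-(1 / 2) : ℝ) :=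
          intervalIntegral.integral_const_mul _ _
      _ ≤ (1 - x ^ 2) ^ (a - μ) * 2 := by gcongr
  unfold weightedIntegral
  rw [abs_of_nonneg (by positivity)]
  calc (1 - x ^ 2) ^ μ * ∫ t in (0 : ℝ)..x, (1 - t ^ 2) ^ (-μ)
      ≤ (1 - x ^ 2) ^ μ * ((1 - x ^ 2) ^ (a - μ) * 2) := by gcongr
    _ = 2 * (1 - x ^ 2) ^ a := by
      rw [← mul_assoc, ← Real.rpow_add hs]
      ring_nf

theorem hasDerivAt_weightedIntegral (μ : ℝ) {x : ℝ} (hx : x ∈ Set.Ioo (-1 : ℝ) 1) :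
    HasDerivAt (weightedIntegral μ)
      (1 - 2 * μ * x * ((1 - x ^ 2)⁻¹ * weightedIntegral μ x)) x := by
  have hs := one_sub_sq_pos hx
  refine ((hasDerivAt_one_sub_sq_rpow μ hx).mul
    (hasDerivAt_integral_one_sub_sq_rpow (-μ) hx)).congr_deriv ?_
  rw [← Real.rpow_add hs, Real.rpow_sub_one hs.ne', weightedIntegral]
  simp only [add_neg_cancel, Real.rpow_zero]
  field_simp
  ring

theorem continuousOn_weightedIntegral {μ : ℝ} (hμ : 0 < μ) :
    ContinuousOn (weightedIntegral μ) (Set.Icc 0 1) := by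
  intro x hx
  rcases hx.2.lt_or_eq with h | rfl
  · exact (hasDerivAt_weightedIntegral μ ⟨by linarith [hx.1], h⟩).continuousAt.continuousWithinAt
  have ha : 0 < min μ (1 / 2) := by positivity
  have h1 : weightedIntegral μ 1 = 0 := by simp [weightedIntegral, hμ.ne']
  have hbound : ∀ y ∈ Set.Icc (0 : ℝ) 1,
      ‖weightedIntegral μ y‖ ≤ 2 * (1 - y ^ 2) ^ min μ (1 / 2) := by
    intro y hy
    rcases hy.2.lt_or_eq with h | rfl
    · exact abs_weightedIntegral_le (min_le_right _ _) (min_le_left _ _) ⟨hy.1, h⟩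
    · rw [h1, one_pow, sub_self, Real.zero_rpow ha.ne']
      simp
  have hlim : Filter.Tendsto (fun y : ℝ => 2 * (1 - y ^ 2) ^ min μ (1 / 2))
      (nhdsWithin 1 (Set.Icc 0 1)) (nhds 0) := by
    have hc : Continuous fun y : ℝ => 2 * (1 - y ^ 2) ^ min μ (1 / 2) :=
      continuous_const.mul (Continuous.rpow_const (by fun_prop) fun _ => Or.inr ha.le)
    have := hc.tendsto 1
    simp only [one_pow, sub_self, Real.zero_rpow ha.ne', mul_zero] at this
    exact this.mono_left nhdsWithin_le_nhds
  rw [ContinuousWithinAt, h1]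
  exact squeeze_zero_norm' (eventually_mem_nhdsWithin.mono hbound) hlim

theorem one_sub_sq_rpow_le {a : ℝ} (ha : a ≤ 1) {x : ℝ} (hx : x ∈ Set.Ioo (0 : ℝ) 1) :
    (1 - x ^ 2) ^ (a - 1) ≤ (1 - x) ^ (a - 1) :=
  Real.rpow_le_rpow_of_nonpos (by linarith [hx.2]) (by nlinarith [hx.1, hx.2]) (by linarith)

theorem abs_weightedIntegral_sub_le {μ a : ℝ} (ha : 0 < a) (ha2 : a ≤ 1 / 2) (haμ : a ≤ μ) :
    ∀ x ∈ Set.Icc (0 : ℝ) 1, ∀ y ∈ Set.Icc (0 : ℝ) 1,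
      |weightedIntegral μ x - weightedIntegral μ y| ≤ (1 + 4 * μ) / a * |x - y| ^ a := by
  have hμ : 0 < μ := ha.trans_le haμ
  refine abs_sub_le_of_abs_deriv_le_rpow ha (by linarith) (by positivity)
    (continuousOn_weightedIntegral hμ)
    (fun x hx => hasDerivAt_weightedIntegral μ ⟨by linarith [hx.1], hx.2⟩) fun x hx => ?_
  have hs : 0 < 1 - x ^ 2 := one_sub_sq_pos ⟨by linarith [hx.1], hx.2⟩
  have hle := one_sub_sq_rpow_le (a := a) (by linarith) hx
  have hone : 1 ≤ (1 - x) ^ (a - 1) :=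
    Real.one_le_rpow_of_pos_of_le_one_of_nonpos (by linarith [hx.2]) (by linarith [hx.1])
      (by linarith)
  have hg : |(1 - x ^ 2)⁻¹ * weightedIntegral μ x| ≤ 2 * (1 - x) ^ (a - 1) := by
    rw [abs_mul, abs_of_pos (inv_pos.2 hs)]
    calc (1 - x ^ 2)⁻¹ * |weightedIntegral μ x| ≤ (1 - x ^ 2)⁻¹ * (2 * (1 - x ^ 2) ^ a) := by
          gcongr
          exact abs_weightedIntegral_le ha2 haμ ⟨hx.1.le, hx.2⟩
      _ = 2 * (1 - x ^ 2) ^ (a - 1) := by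
          rw [Real.rpow_sub_one hs.ne']
          ring
      _ ≤ 2 * (1 - x) ^ (a - 1) := by gcongr
  calc |1 - 2 * μ * x * ((1 - x ^ 2)⁻¹ * weightedIntegral μ x)|
      ≤ |1| + |2 * μ * x * ((1 - x ^ 2)⁻¹ * weightedIntegral μ x)| := abs_sub _ _
    _ = 1 + 2 * μ * x * |(1 - x ^ 2)⁻¹ * weightedIntegral μ x| := by
        rw [abs_one, abs_mul (2 * μ * x), abs_of_nonneg (by have := hx.1; positivity)]
    _ ≤ (1 - x) ^ (a - 1) + 2 * μ * 1 * (2 * (1 - x) ^ (a - 1)) := by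
        have := hx.1
        have := hx.2.le
        gcongr
    _ = (1 + 4 * μ) * (1 - x) ^ (a - 1) := by ring

theorem abs_one_sub_sq_rpow_sub_le {μ a : ℝ} (ha : 0 < a) (ha1 : a ≤ 1) (haμ : a ≤ μ) :
    ∀ x ∈ Set.Icc (0 : ℝ) 1, ∀ y ∈ Set.Icc (0 : ℝ) 1,
      |(1 - x ^ 2) ^ μ - (1 - y ^ 2) ^ μ| ≤ 2 * μ / a * |x - y| ^ a := by
  have hμ : 0 < μ := ha.trans_le haμ
  refine abs_sub_le_of_abs_deriv_le_rpow (f := fun x => (1 - x ^ 2) ^ μ) ha ha1 (by positivity)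
    (ContinuousOn.rpow_const (by fun_prop) fun _ _ => Or.inr hμ.le)
    (fun x hx => hasDerivAt_one_sub_sq_rpow μ ⟨by linarith [hx.1], hx.2⟩) fun x hx => ?_
  have hs : 0 < 1 - x ^ 2 := one_sub_sq_pos ⟨by linarith [hx.1], hx.2⟩
  have h1 : (1 - x ^ 2) ^ (μ - 1) ≤ (1 - x) ^ (a - 1) :=
    (Real.rpow_le_rpow_of_exponent_ge hs (by nlinarith) (by linarith)).trans
      (one_sub_sq_rpow_le ha1 hx)
  have hx0 := hx.1
  have hx1 := hx.2.le
  rw [abs_neg, abs_of_nonneg (by positivity)]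
  calc 2 * μ * x * (1 - x ^ 2) ^ (μ - 1) ≤ 2 * μ * 1 * (1 - x) ^ (a - 1) := by gcongr
    _ = 2 * μ * (1 - x) ^ (a - 1) := by ring

/-- The continuous extension of `qFun` to `[-1, 1]`. -/
def qBar (ν x : ℝ) : ℝ :=
  2 * ν * (x / (2 * ν - 1) + (1 - 1 / (2 * ν - 1)) * weightedIntegral (ν - 1 / 2) x)

theorem qFun_eq_qBar {ν : ℝ} (hν : 1 / 2 < ν) {x : ℝ} (hx : x ∈ Set.Ioo (-1 : ℝ) 1) :
    qFun ν x = qBar ν x := by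
  have hs := one_sub_sq_pos hx
  have h := integral_one_sub_sq_rpow_reduction (μ := ν - 1 / 2) (by linarith) hx
  have hexp : -(ν - 1 / 2) - 1 = -ν - 1 / 2 := by ring
  have hcoef : 2 * (ν - 1 / 2) = 2 * ν - 1 := by ring
  rw [hexp, hcoef] at h
  have hone : (1 - x ^ 2) ^ (ν - 1 / 2) * (1 - x ^ 2) ^ (-(ν - 1 / 2)) = 1 := by
    rw [← Real.rpow_add hs, add_neg_cancel, Real.rpow_zero]
  rw [qFun, qBar, weightedIntegral, h]
  linear_combination 2 * ν * (x / (2 * ν - 1)) * hone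

theorem qBar_neg (ν x : ℝ) : qBar ν (-x) = -qBar ν x := by
  rw [qBar, qBar, weightedIntegral_neg]
  ring

theorem continuousOn_qBar {ν : ℝ} (hν : 1 / 2 < ν) :
    ContinuousOn (qBar ν) (Set.Icc 0 1) := by
  have := continuousOn_weightedIntegral (μ := ν - 1 / 2) (by linarith)
  unfold qBar
  fun_prop

theorem exists_abs_qBar_sub_le {ν a : ℝ} (ha : 0 < a) (ha2 : a ≤ 1 / 2) (haν : a ≤ ν - 1 / 2) :
    ∃ L : ℝ, 0 ≤ L ∧ ∀ x ∈ Set.Icc (0 : ℝ) 1, ∀ y ∈ Set.Icc (0 : ℝ) 1,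
      |qBar ν x - qBar ν y| ≤ L * |x - y| ^ a := by
  have hμ : 0 < ν - 1 / 2 := ha.trans_le haν
  refine ⟨|2 * ν| * (|(2 * ν - 1)⁻¹| +
    |1 - 1 / (2 * ν - 1)| * ((1 + 4 * (ν - 1 / 2)) / a)), by positivity, fun x hx y hy => ?_⟩
  have hg := abs_weightedIntegral_sub_le ha ha2 haν x hx y hy
  have hxy : |x - y| ≤ |x - y| ^ a := by
    refine Real.self_le_rpow_of_le_one (abs_nonneg _) ?_ (by linarith)
    rw [abs_le]
    constructor <;> linarith [hx.1, hx.2, hy.1, hy.2]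
  calc |qBar ν x - qBar ν y|
      = |2 * ν| * |(2 * ν - 1)⁻¹ * (x - y) + (1 - 1 / (2 * ν - 1)) *
          (weightedIntegral (ν - 1 / 2) x - weightedIntegral (ν - 1 / 2) y)| := by
        rw [← abs_mul, qBar, qBar]
        ring_nf
    _ ≤ |2 * ν| * (|(2 * ν - 1)⁻¹| * |x - y| + |1 - 1 / (2 * ν - 1)| *
          |weightedIntegral (ν - 1 / 2) x - weightedIntegral (ν - 1 / 2) y|) := by
        rw [← abs_mul (2 * ν - 1)⁻¹, ← abs_mul (1 - 1 / (2 * ν - 1))]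
        gcongr
        exact abs_add_le _ _
    _ ≤ |2 * ν| * (|(2 * ν - 1)⁻¹| * |x - y| ^ a + |1 - 1 / (2 * ν - 1)| *
          ((1 + 4 * (ν - 1 / 2)) / a * |x - y| ^ a)) := by gcongr
    _ = _ := by ring

/-- The reciprocal of the continuous extension of `PhiFun` to `[-1, 1]`. -/
def denBar (ν x : ℝ) : ℝ := qBar ν x ^ 2 + Real.pi ^ 2 / beta0 ν ^ 2 * wFun ν x ^ 2

theorem denBar_abs (ν x : ℝ) : denBar ν |x| = denBar ν x := by
  rcases abs_choice x with h | h <;> rw [h]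
  simp [denBar, wFun, qBar_neg]

theorem denBar_pos {ν : ℝ} (hν : 1 / 2 < ν) {x : ℝ} (hx : x ∈ Set.Icc (0 : ℝ) 1) :
    0 < denBar ν x := by
  rcases hx.2.lt_or_eq with h | rfl
  · have hw : 0 < wFun ν x := Real.rpow_pos_of_pos (one_sub_sq_pos ⟨by linarith [hx.1], h⟩) _
    have hβ : 0 < beta0 ν := by
      have h1 : 0 < Real.Gamma (ν + 1 / 2) := Real.Gamma_pos_of_pos (by linarith)
      have h2 : 0 < Real.Gamma (2 * ν + 1) := Real.Gamma_pos_of_pos (by linarith)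
      unfold beta0
      positivity
    unfold denBar
    have := Real.pi_pos
    positivity
  · have hq : 0 < qBar ν 1 := by
      have h1 : 0 < 2 * ν - 1 := by linarith
      have h2 : 0 < ν := by linarith
      have h3 : weightedIntegral (ν - 1 / 2) 1 = 0 := by
        rw [weightedIntegral, one_pow, sub_self, Real.zero_rpow (by linarith), zero_mul]
      rw [qBar, h3, mul_zero, add_zero]
      positivity
    unfold denBar
    positivity

theorem continuousOn_denBar {ν : ℝ} (hν : 1 / 2 < ν) :
    ContinuousOn (denBar ν) (Set.Icc 0 1) := by
  have hq := continuousOn_qBar hν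
  have hw : ContinuousOn (wFun ν) (Set.Icc 0 1) :=
    ContinuousOn.rpow_const (by fun_prop) fun _ _ => Or.inr (by linarith)
  unfold denBar
  fun_prop

theorem abs_sq_sub_sq_le {u v M d : ℝ} (hu : |u| ≤ M) (hv : |v| ≤ M) (hd : |u - v| ≤ d) :
    |u ^ 2 - v ^ 2| ≤ 2 * M * d := by
  rw [sq_sub_sq, abs_mul]
  have hM : 0 ≤ M := (abs_nonneg u).trans hu
  refine mul_le_mul ((abs_add_le u v).trans (by linarith)) hd (abs_nonneg _) (by positivity)

theorem exists_abs_denBar_sub_le {ν a : ℝ} (ha : 0 < a) (ha2 : a ≤ 1 / 2)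
    (haν : a ≤ ν - 1 / 2) :
    ∃ L : ℝ, 0 ≤ L ∧ ∀ x ∈ Set.Icc (0 : ℝ) 1, ∀ y ∈ Set.Icc (0 : ℝ) 1,
      |denBar ν x - denBar ν y| ≤ L * |x - y| ^ a := by
  obtain ⟨L, hL, hq⟩ := exists_abs_qBar_sub_le ha ha2 haν
  obtain ⟨M, hM⟩ := isCompact_Icc.exists_bound_of_continuousOn
    (continuousOn_qBar (ν := ν) (by linarith))
  have hM0 : 0 ≤ M := (norm_nonneg _).trans (hM 0 (by simp))
  have hμ : 0 < ν - 1 / 2 := ha.trans_le haν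
  have hw1 : ∀ x ∈ Set.Icc (0 : ℝ) 1, |wFun ν x| ≤ 1 := by
    intro x hx
    have hs : 0 ≤ 1 - x ^ 2 := by nlinarith [hx.1, hx.2]
    rw [wFun, abs_of_nonneg (Real.rpow_nonneg hs _)]
    exact Real.rpow_le_one hs (by nlinarith) hμ.le
  refine ⟨2 * M * L + Real.pi ^ 2 / beta0 ν ^ 2 * (2 * 1 * (2 * (ν - 1 / 2) / a)),
    by positivity, fun x hx y hy => ?_⟩
  calc |denBar ν x - denBar ν y|
      = |(qBar ν x ^ 2 - qBar ν y ^ 2) +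
          Real.pi ^ 2 / beta0 ν ^ 2 * (wFun ν x ^ 2 - wFun ν y ^ 2)| := by
        rw [denBar, denBar]
        ring_nf
    _ ≤ |qBar ν x ^ 2 - qBar ν y ^ 2| +
          Real.pi ^ 2 / beta0 ν ^ 2 * |wFun ν x ^ 2 - wFun ν y ^ 2| := by
        refine (abs_add_le _ _).trans_eq ?_
        rw [abs_mul, abs_of_nonneg (a := Real.pi ^ 2 / beta0 ν ^ 2) (by positivity)]
    _ ≤ 2 * M * (L * |x - y| ^ a) + Real.pi ^ 2 / beta0 ν ^ 2 *
          (2 * 1 * (2 * (ν - 1 / 2) / a * |x - y| ^ a)) := by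
        gcongr
        · exact abs_sq_sub_sq_le (hM x hx) (hM y hy) (hq x hx y hy)
        · exact abs_sq_sub_sq_le (hw1 x hx) (hw1 y hy)
            (abs_one_sub_sq_rpow_sub_le ha (by linarith) haν x hx y hy)
    _ = _ := by ring

theorem Phi_extends_positive_Hoelder (ν : ℝ) (hν : 1 / 2 < ν) :
    ∃ α : ℝ, α ∈ Set.Ioc (0 : ℝ) 1 ∧ ∃ C : ℝ, 0 < C ∧ ∃ Φbar : ℝ → ℝ,
      (∀ x ∈ Set.Ioo (-1 : ℝ) 1, Φbar x = PhiFun ν x) ∧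
      (∀ x ∈ Set.Icc (-1 : ℝ) 1, 0 < Φbar x) ∧
      (∀ x ∈ Set.Icc (-1 : ℝ) 1, ∀ x' ∈ Set.Icc (-1 : ℝ) 1,
        |Φbar x - Φbar x'| ≤ C * |x - x'| ^ α) := by
  have hμ : 0 < ν - 1 / 2 := by linarith
  obtain ⟨a, ha, ha2, haν⟩ : ∃ a : ℝ, 0 < a ∧ a ≤ 1 / 2 ∧ a ≤ ν - 1 / 2 :=
    ⟨min (ν - 1 / 2) (1 / 2), by positivity, min_le_right _ _, min_le_left _ _⟩
  obtain ⟨L, hL, hLip⟩ := exists_abs_denBar_sub_le ha ha2 haν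
  obtain ⟨z, hz, hmin⟩ := isCompact_Icc.exists_isMinOn (Set.nonempty_Icc.2 zero_le_one)
    (continuousOn_denBar hν)
  have hm : 0 < denBar ν z := denBar_pos hν hz
  have habs : ∀ x ∈ Set.Icc (-1 : ℝ) 1, |x| ∈ Set.Icc (0 : ℝ) 1 :=
    fun x hx => ⟨abs_nonneg x, abs_le.2 hx⟩
  have hlow : ∀ x ∈ Set.Icc (-1 : ℝ) 1, denBar ν z ≤ denBar ν x := fun x hx => by
    rw [← denBar_abs ν x]
    exact hmin (habs x hx)
  refine ⟨a, ⟨ha, by linarith⟩, L / denBar ν z ^ 2 + 1, by positivity,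
    fun x => 1 / denBar ν x, ?_, ?_, ?_⟩
  · intro x hx
    rw [PhiFun, qFun_eq_qBar hν hx]
    rfl
  · intro x hx
    exact one_div_pos.2 (hm.trans_le (hlow x hx))
  · intro x hx y hy
    have hDx := hm.trans_le (hlow x hx)
    have hDy := hm.trans_le (hlow y hy)
    have hnum : |denBar ν y - denBar ν x| ≤ L * |x - y| ^ a := by
      rw [← denBar_abs ν y, ← denBar_abs ν x]
      refine (hLip _ (habs y hy) _ (habs x hx)).trans ?_
      rw [abs_sub_comm x y]
      have := abs_abs_sub_abs_le_abs_sub y x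
      gcongr
    calc |1 / denBar ν x - 1 / denBar ν y|
        = |denBar ν y - denBar ν x| / (denBar ν x * denBar ν y) := by
          rw [div_sub_div _ _ hDx.ne' hDy.ne', abs_div, abs_of_pos (mul_pos hDx hDy)]
          ring_nf
      _ ≤ L * |x - y| ^ a / (denBar ν z * denBar ν z) := by
          gcongr
          · exact hlow x hx
          · exact hlow y hy
      _ ≤ (L / denBar ν z ^ 2 + 1) * |x - y| ^ a := by
          have : 0 ≤ |x - y| ^ a := by positivity
          rw [add_mul, one_mul, div_mul_eq_mul_div, ← sq]
          linarith

end
end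

section
/- For every real ν > 1/2 there exists a constant C > 0 such that for all real λ < 2ν, all integers n ≥ 1 and all x ∈ [−1,1]: P^{(ν)*}_n(1, λ) > 0 and |P^{(ν)*}_n(x, λ)| ≤ ((1+|λ|)/(2ν−λ)) · (C/(√(1−x²)·n + 1)^ν) · P^{(ν)*}_n(1, λ). -/
open Polynomial Filter MeasureTheory

noncomputable section

/-- Recurrence coefficients `β_k = k(k+2ν−1)/(4(k+ν)(k+ν−1))` of the monic
ultraspherical polynomials. -/
def ultraBeta (ν : ℝ) (k : ℕ) : ℝ :=
  k * (k + 2 * ν - 1) / (4 * (k + ν) * (k + ν - 1))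

/-- Monic ultraspherical polynomials `P^{(ν)}_0 = 1`, `P^{(ν)}_1 = X`,
`P^{(ν)}_{k+1} = X·P^{(ν)}_k − β_k·P^{(ν)}_{k−1}`. -/
def ultraP (ν : ℝ) : ℕ → Polynomial ℝ
  | 0 => 1
  | 1 => X
  | (k + 2) => X * ultraP ν (k + 1) - C (ultraBeta ν (k + 1)) * ultraP ν k

/-- First-order numerator polynomials `Q^{(ν)}_0 = 1`, `Q^{(ν)}_1 = X`,
`Q^{(ν)}_{k+1} = X·Q^{(ν)}_k − β_{k+1}·Q^{(ν)}_{k−1}`. -/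
def ultraQ (ν : ℝ) : ℕ → Polynomial ℝ
  | 0 => 1
  | 1 => X
  | (k + 2) => X * ultraQ ν (k + 1) - C (ultraBeta ν (k + 2)) * ultraQ ν k

/-- Co-dilated ultraspherical polynomials: same recurrence as `ultraP ν`, except that
the single coefficient `β_1` is replaced by `λ·β_1`. -/
def ultraPstar (ν lam : ℝ) : ℕ → Polynomial ℝ
  | 0 => 1
  | 1 => X
  | (k + 2) => X * ultraPstar ν lam (k + 1) -
      C (if k + 1 = 1 then lam * ultraBeta ν 1 else ultraBeta ν (k + 1)) * ultraPstar ν lam k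

/-- The values `2ⁿ P^{(ν)}_n(1) = (2ν)_n / (ν)_n`. -/
def ultraDominant (ν : ℝ) (n : ℕ) : ℝ :=
  ∏ j ∈ Finset.range n, ((2 * ν + j) / (ν + j))

/-- The second solution `n! / (ν)_n` of the rescaled recurrence at `x = 1`. -/
def ultraMinimal (ν : ℝ) (n : ℕ) : ℝ :=
  ∏ j ∈ Finset.range n, ((1 + j) / (ν + j))

section Coefficients

variable {ν : ℝ}

lemma ultraDominant_succ (n : ℕ) :
    ultraDominant ν (n + 1) = ultraDominant ν n * ((2 * ν + n) / (ν + n)) := by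
  simp only [ultraDominant, Finset.prod_range_succ]

lemma ultraMinimal_succ (n : ℕ) :
    ultraMinimal ν (n + 1) = ultraMinimal ν n * ((1 + n) / (ν + n)) := by
  simp only [ultraMinimal, Finset.prod_range_succ]

lemma ultraDominant_pos (hν : 0 < ν) (n : ℕ) : 0 < ultraDominant ν n :=
  Finset.prod_pos fun _ _ => by positivity

lemma ultraMinimal_pos (hν : 0 < ν) (n : ℕ) : 0 < ultraMinimal ν n :=
  Finset.prod_pos fun _ _ => by positivity

lemma ultraDominant_monotone (hν : 0 < ν) : Monotone (ultraDominant ν) :=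
  monotone_nat_of_le_succ fun n => by
    rw [ultraDominant_succ]
    refine le_mul_of_one_le_right (ultraDominant_pos hν n).le ?_
    rw [one_le_div (by positivity)]
    linarith

lemma ultraDominant_succ_le (hν : 0 < ν) (n : ℕ) :
    ultraDominant ν (n + 1) ≤ 2 * ultraDominant ν n := by
  rw [ultraDominant_succ, mul_comm]
  refine mul_le_mul_of_nonneg_right ?_ (ultraDominant_pos hν n).le
  rw [div_le_iff₀ (by positivity)]
  linarith [(Nat.cast_nonneg n : (0 : ℝ) ≤ n)]

lemma four_mul_ultraBeta_succ (hν : 0 < ν) (k : ℕ) :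
    4 * ultraBeta ν (k + 1) = 1 - ν * (ν - 1) * (1 / (k + ν) - 1 / (k + 1 + ν)) := by
  have h1 : (k : ℝ) + ν ≠ 0 := by positivity
  have h2 : (k : ℝ) + 1 + ν ≠ 0 := by positivity
  have h3 : ((k + 1 : ℕ) : ℝ) + ν - 1 = k + ν := by push_cast; ring
  rw [ultraBeta, h3]
  push_cast
  field_simp
  ring

lemma inv_sub_inv_succ_nonneg (hν : 0 < ν) (k : ℕ) :
    0 ≤ 1 / ((k : ℝ) + ν) - 1 / (k + 1 + ν) :=
  sub_nonneg.2 (one_div_le_one_div_of_le (by positivity) (by linarith))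

lemma abs_one_sub_four_mul_ultraBeta (hν : 0 < ν) (k : ℕ) :
    |1 - 4 * ultraBeta ν (k + 1)| = |ν * (ν - 1)| * (1 / (k + ν) - 1 / (k + 1 + ν)) := by
  rw [four_mul_ultraBeta_succ hν, sub_sub_cancel, abs_mul,
    abs_of_nonneg (inv_sub_inv_succ_nonneg hν k)]

lemma ultraDominant_recurrence (hν : 0 < ν) (k : ℕ) :
    ultraDominant ν (k + 2) =
      2 * ultraDominant ν (k + 1) - 4 * ultraBeta ν (k + 1) * ultraDominant ν k := by
  rw [ultraDominant_succ (k + 1), ultraDominant_succ k, four_mul_ultraBeta_succ hν]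
  have h1 : (k : ℝ) + ν ≠ 0 := by positivity
  have h2 : (k : ℝ) + 1 + ν ≠ 0 := by positivity
  have h3 : ν + (k : ℝ) ≠ 0 := by positivity
  have h4 : ν + ((k : ℝ) + 1) ≠ 0 := by positivity
  push_cast
  field_simp
  ring

lemma ultraMinimal_recurrence (hν : 0 < ν) (k : ℕ) :
    ultraMinimal ν (k + 2) =
      2 * ultraMinimal ν (k + 1) - 4 * ultraBeta ν (k + 1) * ultraMinimal ν k := by
  rw [ultraMinimal_succ (k + 1), ultraMinimal_succ k, four_mul_ultraBeta_succ hν]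
  have h1 : (k : ℝ) + ν ≠ 0 := by positivity
  have h2 : (k : ℝ) + 1 + ν ≠ 0 := by positivity
  have h3 : ν + (k : ℝ) ≠ 0 := by positivity
  have h4 : ν + ((k : ℝ) + 1) ≠ 0 := by positivity
  push_cast
  field_simp
  ring

lemma ultraMinimal_le_ultraDominant (hν : 1 / 2 < ν) {n : ℕ} (hn : 2 ≤ n) :
    ν * (2 * ν + 1) * ultraMinimal ν n ≤ ultraDominant ν n := by
  have hν0 : 0 < ν := by linarith
  induction n, hn using Nat.le_induction with
  | base =>
    simp only [ultraMinimal, ultraDominant, Finset.prod_range_succ, Finset.prod_range_zero]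
    push_cast
    apply le_of_eq
    field_simp
    ring
  | succ n hn ih =>
    rw [ultraMinimal_succ, ultraDominant_succ, ← mul_assoc]
    refine mul_le_mul ih ?_ (by positivity) (ultraDominant_pos hν0 n).le
    gcongr
    linarith

lemma ultraDominant_succ_eq_gammaSeq (hν : 0 < ν) {n : ℕ} (hn : 1 ≤ n) :
    ultraDominant ν (n + 1) / (n : ℝ) ^ ν = Real.GammaSeq ν n / Real.GammaSeq (2 * ν) n := by
  have hn0 : (0 : ℝ) < n := by exact_mod_cast hn
  have h1 : 0 < ∏ j ∈ Finset.range (n + 1), (ν + (j : ℝ)) :=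
    Finset.prod_pos fun _ _ => by positivity
  have h2 : 0 < ∏ j ∈ Finset.range (n + 1), (2 * ν + (j : ℝ)) :=
    Finset.prod_pos fun _ _ => by positivity
  have h3 : (0 : ℝ) < (n : ℝ) ^ ν := by positivity
  have h4 : (n : ℝ) ^ (2 * ν) = (n : ℝ) ^ ν * (n : ℝ) ^ ν := by
    rw [two_mul, Real.rpow_add hn0]
  rw [ultraDominant, Finset.prod_div_distrib, Real.GammaSeq, Real.GammaSeq, h4]
  field_simp

lemma exists_ultraDominant_bounds (hν : 0 < ν) :
    ∃ c C : ℝ, 0 < c ∧ 0 < C ∧ ∀ n : ℕ, 1 ≤ n →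
      c * (n : ℝ) ^ ν ≤ ultraDominant ν n ∧ ultraDominant ν n ≤ C * (n : ℝ) ^ ν := by
  have hg1 := Real.Gamma_pos_of_pos hν
  have hg2 := Real.Gamma_pos_of_pos (show 0 < 2 * ν by linarith)
  have key : Tendsto (fun n : ℕ => ultraDominant ν (n + 1) / (n : ℝ) ^ ν) atTop
      (nhds (Real.Gamma ν / Real.Gamma (2 * ν))) := by
    refine ((Real.GammaSeq_tendsto_Gamma ν).div (Real.GammaSeq_tendsto_Gamma (2 * ν))
      hg2.ne').congr' ?_
    filter_upwards [eventually_ge_atTop 1] with n hn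
    exact (ultraDominant_succ_eq_gammaSeq hν hn).symm
  obtain ⟨A, hA⟩ := key.bddAbove_range
  obtain ⟨A', hA'⟩ := (key.inv₀ (by positivity)).bddAbove_range
  have hpow : ∀ n : ℕ, 1 ≤ n → 0 < (n : ℝ) ^ ν := fun n hn =>
    Real.rpow_pos_of_pos (by exact_mod_cast hn) _
  have hq : ∀ n : ℕ, 1 ≤ n → 0 < ultraDominant ν (n + 1) / (n : ℝ) ^ ν := fun n hn =>
    div_pos (ultraDominant_pos hν _) (hpow n hn)
  have hA_pos : 0 < A := (hq 1 le_rfl).trans_le (hA ⟨1, rfl⟩)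
  have hA'_pos : 0 < A' := (inv_pos.2 (hq 1 le_rfl)).trans_le (hA' ⟨1, rfl⟩)
  refine ⟨A'⁻¹ / 2, A, by positivity, hA_pos, fun n hn => ⟨?_, ?_⟩⟩
  · have h1 := inv_le_of_inv_le₀ (hq n hn) (hA' ⟨n, rfl⟩)
    rw [le_div_iff₀ (hpow n hn)] at h1
    linarith [ultraDominant_succ_le hν n]
  · have h1 : ultraDominant ν (n + 1) / (n : ℝ) ^ ν ≤ A := hA ⟨n, rfl⟩
    rw [div_le_iff₀ (hpow n hn)] at h1
    exact (ultraDominant_monotone hν n.le_succ).trans h1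

end Coefficients

lemma le_exp_mul_of_step_le {ν t e : ℝ} (hν : 0 < ν) (ht : 0 ≤ t) (he : 0 ≤ e) {a : ℕ → ℝ}
    {m n : ℕ} (ha : 0 ≤ a m) (hmn : m ≤ n)
    (hstep : ∀ k, m ≤ k → k < n →
      a (k + 1) ≤ (1 + t * (1 / (k + ν) - 1 / (k + 1 + ν))) * a k + e) :
    a n ≤ Real.exp (t / (m + ν)) * (a m + (n - m) * e) := by
  have key : ∀ j, m ≤ j → j ≤ n →
      a j ≤ Real.exp (t / (m + ν) - t / (j + ν)) * (a m + (j - m) * e) := by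
    intro j hj
    induction j, hj using Nat.le_induction with
    | base => intro _; simp
    | succ k hk ih =>
      intro hkn
      have hmk : (m : ℝ) ≤ k := by exact_mod_cast hk
      have hd := inv_sub_inv_succ_nonneg hν k
      have h1 : 1 + t * (1 / ((k : ℝ) + ν) - 1 / (k + 1 + ν)) ≤
          Real.exp (t / (k + ν) - t / (k + 1 + ν)) := by
        refine le_trans (le_of_eq ?_) (Real.add_one_le_exp _)
        ring
      have h2 : 1 ≤ Real.exp (t / (m + ν) - t / ((k : ℝ) + 1 + ν)) := by
        refine Real.one_le_exp (sub_nonneg.2 ?_)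
        gcongr
        linarith
      have h3 : 0 ≤ a m + (k - m) * e := add_nonneg ha (mul_nonneg (by linarith) he)
      calc a (k + 1) ≤ (1 + t * (1 / (k + ν) - 1 / (k + 1 + ν))) * a k + e :=
            hstep k hk (by omega)
        _ ≤ (1 + t * (1 / (k + ν) - 1 / (k + 1 + ν))) *
            (Real.exp (t / (m + ν) - t / (k + ν)) * (a m + (k - m) * e)) + e := by
            gcongr
            exact ih (by omega)
        _ ≤ Real.exp (t / (k + ν) - t / (k + 1 + ν)) *
            (Real.exp (t / (m + ν) - t / (k + ν)) * (a m + (k - m) * e)) +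
            Real.exp (t / (m + ν) - t / ((k : ℝ) + 1 + ν)) * e := by
            gcongr
            exact le_mul_of_one_le_left he h2
        _ = Real.exp (t / (m + ν) - t / ((k : ℝ) + 1 + ν)) * (a m + (k + 1 - m) * e) := by
            rw [← mul_assoc, ← Real.exp_add, add_comm (_ - _) (_ - _), sub_add_sub_cancel]
            ring
        _ = _ := by push_cast; ring
  refine (key n hmn le_rfl).trans ?_
  have hmn' : (m : ℝ) ≤ n := by exact_mod_cast hmn
  have h3 : 0 ≤ a m + (n - m) * e := add_nonneg ha (mul_nonneg (by linarith) he)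
  gcongr
  exact sub_le_self _ (by positivity)

/-- The rescaled three-term recurrence satisfied by `2ⁿ P^{(ν)}_n(x)`, from index `1` on. -/
def UltraRecurrence (ν x : ℝ) (u : ℕ → ℝ) : Prop :=
  ∀ k : ℕ, 1 ≤ k → u (k + 2) = 2 * x * u (k + 1) - 4 * ultraBeta ν (k + 1) * u k

/-- The Casoratian of `ultraDominant ν` and `u`. -/
def ultraCasoratian (ν : ℝ) (u : ℕ → ℝ) (n : ℕ) : ℝ :=
  ultraDominant ν n * u (n + 1) - ultraDominant ν (n + 1) * u n

section Recurrence

variable {ν x : ℝ} {u : ℕ → ℝ}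

lemma ultraCasoratian_succ (hν : 0 < ν) (hu : UltraRecurrence ν x u) {k : ℕ} (hk : 1 ≤ k) :
    ultraCasoratian ν u (k + 1) = 4 * ultraBeta ν (k + 1) * ultraCasoratian ν u k -
      2 * (1 - x) * (ultraDominant ν (k + 1) * u (k + 1)) := by
  simp only [ultraCasoratian]
  rw [hu k hk, ultraDominant_recurrence hν k]
  ring

lemma one_sub_le_one_sub_sq (hx : x ∈ Set.Icc (0 : ℝ) 1) : 1 - x ≤ 1 - x ^ 2 := by
  nlinarith [hx.1, hx.2]

lemma abs_ultraCasoratian_le (hν : 0 < ν) (hx : x ∈ Set.Icc (0 : ℝ) 1)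
    (hu : UltraRecurrence ν x u) {n : ℕ} (hn : 1 ≤ n) {M : ℝ} (hM : 0 ≤ M)
    (hb : ∀ j, 1 ≤ j → j ≤ n → |u j| ≤ M * ultraDominant ν j) :
    |ultraCasoratian ν u n| ≤ Real.exp (|ν * (ν - 1)|) *
      (|ultraCasoratian ν u 1| + n * (2 * (1 - x ^ 2) * M * ultraDominant ν n ^ 2)) := by
  have hs : 0 ≤ 1 - x ^ 2 := by nlinarith [hx.1, hx.2]
  have he : 0 ≤ 2 * (1 - x ^ 2) * M * ultraDominant ν n ^ 2 := by positivity
  have key := le_exp_mul_of_step_le (t := |ν * (ν - 1)|) hν (abs_nonneg _) he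
    (a := fun k => |ultraCasoratian ν u k|) (abs_nonneg _) hn fun k hk hkn => by
      have hβ : |4 * ultraBeta ν (k + 1)| ≤
          1 + |ν * (ν - 1)| * (1 / (k + ν) - 1 / (k + 1 + ν)) := by
        rw [← abs_one_sub_four_mul_ultraBeta hν]
        have h := abs_sub (1 : ℝ) (1 - 4 * ultraBeta ν (k + 1))
        rwa [sub_sub_cancel, abs_one] at h
      have hd := (ultraDominant_pos hν (k + 1)).le
      have hmono := ultraDominant_monotone hν (show k + 1 ≤ n by omega)
      have hsrc : |2 * (1 - x) * (ultraDominant ν (k + 1) * u (k + 1))| ≤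
          2 * (1 - x ^ 2) * M * ultraDominant ν n ^ 2 := by
        have hx1 : 0 ≤ 1 - x := by linarith [hx.2]
        rw [abs_mul, abs_mul (ultraDominant ν (k + 1)), abs_of_nonneg hd,
          abs_of_nonneg (by positivity : 0 ≤ 2 * (1 - x))]
        calc 2 * (1 - x) * (ultraDominant ν (k + 1) * |u (k + 1)|)
            ≤ 2 * (1 - x ^ 2) * (ultraDominant ν n * (M * ultraDominant ν n)) := by
              gcongr 2 * ?_ * (?_ * ?_)
              · exact one_sub_le_one_sub_sq hx
              · exact hd.trans hmono
              · exact (hb _ (by omega) (by omega)).trans (by gcongr)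
          _ = _ := by ring
      simp only [ultraCasoratian_succ hν hu hk]
      refine (abs_sub _ _).trans (add_le_add ?_ hsrc)
      rw [abs_mul]
      gcongr
  refine key.trans ?_
  have h1 : |ν * (ν - 1)| / (((1 : ℕ) : ℝ) + ν) ≤ |ν * (ν - 1)| :=
    div_le_self (abs_nonneg _) (by push_cast; linarith)
  have hn1 : (0 : ℝ) ≤ n - (1 : ℕ) := sub_nonneg.2 (by exact_mod_cast hn)
  gcongr
  exact sub_le_self _ (by positivity)

lemma div_ultraDominant_succ_sub (hν : 0 < ν) (n : ℕ) :
    u (n + 1) / ultraDominant ν (n + 1) - u n / ultraDominant ν n =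
      ultraCasoratian ν u n / (ultraDominant ν n * ultraDominant ν (n + 1)) := by
  have h1 := (ultraDominant_pos hν n).ne'
  have h2 := (ultraDominant_pos hν (n + 1)).ne'
  rw [ultraCasoratian]
  field_simp

lemma summable_inv_ultraDominant (hν : 1 / 2 < ν) :
    Summable fun n : ℕ => 1 / (ultraDominant ν n * ultraDominant ν (n + 1)) := by
  have hν0 : 0 < ν := by linarith
  obtain ⟨c, C, hc, -, hb⟩ := exists_ultraDominant_bounds hν0
  have hsum : Summable fun n : ℕ => (c ^ 2)⁻¹ * (1 / (n : ℝ) ^ (2 * ν)) :=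
    (Real.summable_one_div_nat_rpow.2 (by linarith)).mul_left _
  refine (summable_nat_add_iff 1).1 (Summable.of_nonneg_of_le (fun n => ?_) (fun n => ?_)
    ((summable_nat_add_iff 1).2 hsum))
  · have := ultraDominant_pos hν0 (n + 1)
    have := ultraDominant_pos hν0 (n + 1 + 1)
    positivity
  · have h1 := (hb (n + 1) (by omega)).1
    have h2 := h1.trans (ultraDominant_monotone hν0 (n + 1).le_succ)
    have hn : (0 : ℝ) < ((n + 1 : ℕ) : ℝ) := by positivity
    rw [two_mul, Real.rpow_add hn, ← one_div, one_div_mul_one_div]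
    refine one_div_le_one_div_of_le (by positivity) ?_
    calc c ^ 2 * (((n + 1 : ℕ) : ℝ) ^ ν * ((n + 1 : ℕ) : ℝ) ^ ν)
        = (c * ((n + 1 : ℕ) : ℝ) ^ ν) * (c * ((n + 1 : ℕ) : ℝ) ^ ν) := by ring
      _ ≤ _ := mul_le_mul h1 h2 (by positivity) (ultraDominant_pos hν0 _).le

lemma abs_ultraCasoratian_one_le (hν : 0 < ν) {B : ℝ} (h1 : |u 1| ≤ B) (h2 : |u 2| ≤ B) :
    |ultraCasoratian ν u 1| ≤ (ultraDominant ν 1 + ultraDominant ν 2) * B := by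
  have hd1 := (ultraDominant_pos hν 1).le
  have hd2 := (ultraDominant_pos hν 2).le
  rw [ultraCasoratian]
  refine (abs_sub _ _).trans ?_
  rw [abs_mul, abs_mul, abs_of_nonneg hd1, abs_of_nonneg hd2, add_mul]
  gcongr

/-- Below the turning point `n √(1 - x²) ≈ ε`, solutions are controlled by the dominant solution
at `x = 1`. -/
lemma exists_bound_before_turning (hν : 1 / 2 < ν) :
    ∃ ε K : ℝ, 0 < ε ∧ ε ≤ 1 ∧ 0 < K ∧ ∀ (x : ℝ) (u : ℕ → ℝ) (B : ℝ),
      x ∈ Set.Icc (0 : ℝ) 1 → UltraRecurrence ν x u → |u 1| ≤ B → |u 2| ≤ B →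
      ∀ n : ℕ, 1 ≤ n → ((n : ℝ) - 1) * √(1 - x ^ 2) ≤ ε → |u n| ≤ K * B * ultraDominant ν n := by
  have hν0 : 0 < ν := by linarith
  have hd := ultraDominant_pos hν0
  set G := Real.exp (|ν * (ν - 1)|) with hG
  have hG1 : 1 ≤ G := Real.one_le_exp (abs_nonneg _)
  set f : ℕ → ℝ := fun n => 1 / (ultraDominant ν n * ultraDominant ν (n + 1)) with hf
  have hf0 : ∀ n, 0 ≤ f n := fun n => by
    have := hd n
    have := hd (n + 1)
    positivity
  have hfs : Summable f := summable_inv_ultraDominant hν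
  have hS : 0 ≤ ∑' n, f n := tsum_nonneg hf0
  set A := ultraDominant ν 1 + ultraDominant ν 2 with hA
  have hA0 : 0 < A := add_pos (hd 1) (hd 2)
  set K := 2 * (1 / ultraDominant ν 1 + G * A * ∑' n, f n) with hK
  have hK0 : 0 < K := by
    have := hd 1
    positivity
  refine ⟨1 / (4 * G), K, by positivity, ?_, hK0, ?_⟩
  · rw [div_le_one (by positivity)]
    linarith
  intro x u B hx hu h1 h2 n
  have hB : 0 ≤ B := (abs_nonneg _).trans h1
  have hs : 0 ≤ 1 - x ^ 2 := by nlinarith [hx.1, hx.2]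
  set s := √(1 - x ^ 2) with hs_def
  have hs0 : 0 ≤ s := Real.sqrt_nonneg _
  have hss : s ^ 2 = 1 - x ^ 2 := Real.sq_sqrt hs
  induction n using Nat.strong_induction_on with
  | _ n ih =>
  intro hn hns
  have hn1 : (1 : ℝ) ≤ n := by exact_mod_cast hn
  have hprev : ∀ j, 1 ≤ j → j < n → |u j| ≤ K * B * ultraDominant ν j := fun j hj hjn => by
    refine ih j hjn hj (le_trans ?_ hns)
    gcongr
  have hstep : ∀ j, 1 ≤ j → j < n →
      |u (j + 1) / ultraDominant ν (j + 1) - u j / ultraDominant ν j| ≤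
        G * A * B * f j + 2 * G * s ^ 2 * (n - 1) * (K * B) := by
    intro j hj hjn
    have hdj := hd j
    have hdj1 := hd (j + 1)
    have hjn' : (j : ℝ) ≤ n - 1 := by
      rw [le_sub_iff_add_le]
      exact_mod_cast hjn
    have hmono : ultraDominant ν j ≤ ultraDominant ν (j + 1) :=
      ultraDominant_monotone hν0 j.le_succ
    rw [div_ultraDominant_succ_sub hν0, abs_div, abs_of_pos (mul_pos hdj hdj1)]
    have hc := abs_ultraCasoratian_le hν0 hx hu hj (mul_nonneg hK0.le hB)
      (fun i hi hij => hprev i hi (by omega))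
    have hc1 := abs_ultraCasoratian_one_le hν0 h1 h2
    rw [← hss] at hc
    calc |ultraCasoratian ν u j| / (ultraDominant ν j * ultraDominant ν (j + 1))
        ≤ (G * (A * B + (n - 1) * (2 * s ^ 2 * (K * B) *
            (ultraDominant ν j * ultraDominant ν (j + 1))))) /
            (ultraDominant ν j * ultraDominant ν (j + 1)) := by
          gcongr
          refine hc.trans ?_
          gcongr
          rw [sq]
          gcongr
      _ = _ := by
          simp only [hf]
          field_simp
  have hsum : ∀ j, 1 ≤ j → j ≤ n → |u j / ultraDominant ν j| ≤
      B / ultraDominant ν 1 + G * A * B * ∑ i ∈ Finset.range j, f i +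
        (j - 1) * (2 * G * s ^ 2 * (n - 1) * (K * B)) := by
    intro j hj
    induction j, hj using Nat.le_induction with
    | base =>
      intro _
      have := hf0 0
      have : 0 ≤ G * A * B * f 0 := by positivity
      have hb : |u 1 / ultraDominant ν 1| ≤ B / ultraDominant ν 1 := by
        rw [abs_div, abs_of_pos (hd 1)]
        exact div_le_div_of_nonneg_right h1 (hd 1).le
      simp only [Finset.sum_range_one, Nat.cast_one, sub_self, zero_mul, add_zero]
      linarith
    | succ j hj ihj =>
      intro hjn
      have h3 := hstep j hj (by omega)
      have h4 := ihj (by omega)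
      have h5 := abs_sub_abs_le_abs_sub (u (j + 1) / ultraDominant ν (j + 1))
        (u j / ultraDominant ν j)
      rw [Finset.sum_range_succ]
      push_cast
      linarith
  have hfin := hsum n hn le_rfl
  have htail : ((n : ℝ) - 1) * (2 * G * s ^ 2 * (n - 1) * (K * B)) ≤ K * B / 2 := by
    have h0 : 0 ≤ ((n : ℝ) - 1) * s := mul_nonneg (by linarith) hs0
    have h3 : (((n : ℝ) - 1) * s) ^ 2 ≤ 1 / (4 * G) := by
      have hle : 1 / (4 * G) ≤ 1 := by
        rw [div_le_one (by positivity)]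
        linarith
      calc (((n : ℝ) - 1) * s) ^ 2 ≤ (1 / (4 * G)) ^ 2 := by gcongr
        _ ≤ 1 / (4 * G) := pow_le_of_le_one (by positivity) hle two_ne_zero
    calc ((n : ℝ) - 1) * (2 * G * s ^ 2 * (n - 1) * (K * B))
        = 2 * G * (K * B) * (((n : ℝ) - 1) * s) ^ 2 := by ring
      _ ≤ 2 * G * (K * B) * (1 / (4 * G)) := by gcongr
      _ = K * B / 2 := by field_simp; ring
  have hpart : G * A * B * ∑ i ∈ Finset.range n, f i ≤ G * A * B * ∑' i, f i := by
    gcongr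
    exact hfs.sum_le_tsum _ fun i _ => hf0 i
  have hhead : B / ultraDominant ν 1 + G * A * B * ∑' i, f i = K * B / 2 := by
    rw [hK]
    ring
  rw [abs_div, abs_of_pos (hd n)] at hfin
  rw [← div_le_iff₀ (hd n)]
  linarith

/-- The first-order factor `u_{n+1} - e^{iθ} u_n`, where `x = cos θ`. -/
def ultraWave (x : ℝ) (u : ℕ → ℝ) (n : ℕ) : ℂ :=
  (u (n + 1) : ℂ) - ⟨x, √(1 - x ^ 2)⟩ * (u n : ℂ)

lemma norm_mk_eq_one {y : ℝ} (hy : y ^ 2 = 1 - x ^ 2) :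
    ‖(⟨x, y⟩ : ℂ)‖ = 1 := by
  rw [Complex.norm_def, Complex.normSq_mk, Real.sqrt_eq_one]
  linarith

lemma ultraWave_succ (hx : 0 ≤ 1 - x ^ 2) (hu : UltraRecurrence ν x u) {k : ℕ} (hk : 1 ≤ k) :
    ultraWave x u (k + 1) = ⟨x, -√(1 - x ^ 2)⟩ * ultraWave x u k +
      ((1 - 4 * ultraBeta ν (k + 1)) * u k : ℝ) := by
  have h := Real.sq_sqrt hx
  rw [ultraWave, ultraWave, hu k hk]
  apply Complex.ext
  · simp
    linear_combination u k * h
  · simp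
    ring

lemma sqrt_mul_abs_le_norm_ultraWave (n : ℕ) : √(1 - x ^ 2) * |u n| ≤ ‖ultraWave x u n‖ := by
  refine le_trans (le_of_eq ?_) (Complex.abs_im_le_norm _)
  simp [ultraWave, abs_mul, abs_of_nonneg (Real.sqrt_nonneg _)]

lemma norm_ultraWave_le (hν : 0 < ν) (hs : 0 < √(1 - x ^ 2)) (hu : UltraRecurrence ν x u)
    {m n : ℕ} (hm : 1 ≤ m) (hmn : m ≤ n) :
    ‖ultraWave x u n‖ ≤
      Real.exp (|ν * (ν - 1)| / (√(1 - x ^ 2) * m)) * ‖ultraWave x u m‖ := by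
  have hx := (Real.sqrt_pos.1 hs).le
  have key := le_exp_mul_of_step_le (t := |ν * (ν - 1)| / √(1 - x ^ 2)) (e := 0) hν
    (by positivity) le_rfl (a := fun k => ‖ultraWave x u k‖) (norm_nonneg _) hmn
    fun k hk _ => by
      have hu_le : |u k| ≤ ‖ultraWave x u k‖ / √(1 - x ^ 2) := by
        rw [le_div_iff₀' hs]
        exact sqrt_mul_abs_le_norm_ultraWave k
      simp only [ultraWave_succ hx hu (hm.trans hk)]
      refine (norm_add_le _ _).trans ?_
      rw [norm_mul, norm_mk_eq_one (by rw [neg_sq, Real.sq_sqrt hx]),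
        Complex.norm_real, Real.norm_eq_abs, abs_mul, abs_one_sub_four_mul_ultraBeta hν]
      have hd := inv_sub_inv_succ_nonneg hν k
      calc 1 * ‖ultraWave x u k‖ +
            |ν * (ν - 1)| * (1 / (k + ν) - 1 / (k + 1 + ν)) * |u k|
          ≤ 1 * ‖ultraWave x u k‖ + |ν * (ν - 1)| * (1 / (k + ν) - 1 / (k + 1 + ν)) *
              (‖ultraWave x u k‖ / √(1 - x ^ 2)) := by gcongr
        _ = _ := by ring
  refine key.trans ?_
  have hm0 : (0 : ℝ) < m := by exact_mod_cast hm
  rw [mul_zero, add_zero, div_div]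
  gcongr
  linarith

lemma norm_ultraWave_le_casoratian (hν : 0 < ν) (hx : x ∈ Set.Icc (0 : ℝ) 1) {m : ℕ}
    (hm : 1 ≤ m) :
    ‖ultraWave x u m‖ ≤ |ultraCasoratian ν u m| / ultraDominant ν m +
      (ν / m + 2 * √(1 - x ^ 2)) * |u m| := by
  have hd := ultraDominant_pos hν m
  have hm0 : (0 : ℝ) < m := by exact_mod_cast hm
  have hx2 : 0 ≤ 1 - x ^ 2 := by nlinarith [hx.1, hx.2]
  have hsq := Real.sq_sqrt hx2
  have hsplit : ultraWave x u m = ((ultraCasoratian ν u m / ultraDominant ν m : ℝ) : ℂ) +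
      (((ν / (ν + m) : ℝ) : ℂ) + ⟨1 - x, -√(1 - x ^ 2)⟩) * (u m : ℂ) := by
    have h1 : ultraCasoratian ν u m / ultraDominant ν m =
        u (m + 1) - (1 + ν / (ν + m)) * u m := by
      rw [ultraCasoratian, ultraDominant_succ]
      have : ν + (m : ℝ) ≠ 0 := by positivity
      field_simp
      ring
    rw [h1, ultraWave]
    apply Complex.ext
    · simp only [Complex.sub_re, Complex.add_re, Complex.mul_re, Complex.ofReal_re,
        Complex.ofReal_im]
      ring
    · simp only [Complex.sub_im, Complex.add_im, Complex.mul_im, Complex.ofReal_re,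
        Complex.ofReal_im]
      ring
  have h2 : ‖(⟨1 - x, -√(1 - x ^ 2)⟩ : ℂ)‖ ≤ 2 * √(1 - x ^ 2) := by
    refine abs_le_of_sq_le_sq' ?_ (by positivity) |>.2
    rw [Complex.sq_norm, Complex.normSq_mk]
    nlinarith [one_sub_le_one_sub_sq hx]
  rw [hsplit]
  refine (norm_add_le _ _).trans ?_
  rw [norm_mul, Complex.norm_real, Complex.norm_real, Real.norm_eq_abs, Real.norm_eq_abs,
    abs_div, abs_of_pos hd]
  gcongr
  refine (norm_add_le _ _).trans (add_le_add ?_ h2)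
  rw [Complex.norm_real, Real.norm_eq_abs, abs_of_nonneg (by positivity)]
  gcongr
  linarith

lemma norm_ultraWave_le_of_bounds (hν : 1 / 2 < ν) (hx : x ∈ Set.Icc (0 : ℝ) 1)
    (hu : UltraRecurrence ν x u) {B K ε c : ℝ} (h1 : |u 1| ≤ B) (h2 : |u 2| ≤ B) (hK : 0 < K)
    (hε : 0 < ε) (hc : 0 < c) {m : ℕ} (hm : 1 ≤ m)
    (hcm : c * (m : ℝ) ^ ν ≤ ultraDominant ν m)
    (hlow : ε / 2 ≤ m * √(1 - x ^ 2)) (hup : m * √(1 - x ^ 2) ≤ 1)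
    (hb : ∀ j, 1 ≤ j → j ≤ m → |u j| ≤ K * B * ultraDominant ν j) :
    ‖ultraWave x u m‖ ≤
      (Real.exp (|ν * (ν - 1)|) * ((ultraDominant ν 1 + ultraDominant ν 2) * (2 / (c ^ 2 * ε)) +
        2 * K) + (2 * ν / ε + 2) * K) * (√(1 - x ^ 2) * (B * ultraDominant ν m)) := by
  have hν0 : 0 < ν := by linarith
  have hd := ultraDominant_pos hν0 m
  have hA : 0 < ultraDominant ν 1 + ultraDominant ν 2 :=
    add_pos (ultraDominant_pos hν0 1) (ultraDominant_pos hν0 2)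
  have hm1 : (1 : ℝ) ≤ m := by exact_mod_cast hm
  have hm0 : (0 : ℝ) < m := by linarith
  have hB : 0 ≤ B := (abs_nonneg _).trans h1
  have hx2 : 0 ≤ 1 - x ^ 2 := by nlinarith [hx.1, hx.2]
  have hcas := abs_ultraCasoratian_le hν0 hx hu hm (mul_nonneg hK.le hB) hb
  have hcas1 := abs_ultraCasoratian_one_le hν0 h1 h2
  have hwave := norm_ultraWave_le_casoratian (u := u) hν0 hx hm
  rw [← Real.sq_sqrt hx2] at hcas
  set s := √(1 - x ^ 2)
  set G := Real.exp (|ν * (ν - 1)|)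
  set A := ultraDominant ν 1 + ultraDominant ν 2
  set h := ultraDominant ν m
  have hs0 : 0 ≤ s := Real.sqrt_nonneg _
  have hinv : 1 / (m : ℝ) ≤ 2 * s / ε := by
    rw [div_le_div_iff₀ hm0 hε]
    linarith
  have hsq : c ^ 2 * m ≤ h ^ 2 := by
    calc c ^ 2 * (m : ℝ) = c ^ 2 * (m : ℝ) ^ (1 : ℝ) := by rw [Real.rpow_one]
      _ ≤ c ^ 2 * (m : ℝ) ^ (ν + ν) := by
          refine mul_le_mul_of_nonneg_left ?_ (sq_nonneg c)
          exact Real.rpow_le_rpow_of_exponent_le hm1 (by linarith)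
      _ = (c * (m : ℝ) ^ ν) ^ 2 := by
          rw [Real.rpow_add hm0]
          ring
      _ ≤ h ^ 2 := by gcongr
  have hhinv : 1 / h ≤ 2 / (c ^ 2 * ε) * (s * h) := by
    calc 1 / h ≤ h / (c ^ 2 * m) := by
          rw [div_le_div_iff₀ hd (by positivity)]
          linarith
      _ = h / c ^ 2 * (1 / m) := by field_simp
      _ ≤ h / c ^ 2 * (2 * s / ε) := by gcongr
      _ = _ := by field_simp
  have hterm : |ultraCasoratian ν u m| / h ≤
      G * (A * (2 / (c ^ 2 * ε)) + 2 * K) * (s * (B * h)) := by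
    calc |ultraCasoratian ν u m| / h
        ≤ G * (A * B + m * (2 * s ^ 2 * (K * B) * h ^ 2)) / h := by
          gcongr
          exact hcas.trans (by gcongr)
      _ = G * A * B * (1 / h) + 2 * G * K * B * s * h * (m * s) := by
          field_simp
      _ ≤ G * A * B * (2 / (c ^ 2 * ε) * (s * h)) + 2 * G * K * B * s * h * 1 := by
          gcongr
      _ = _ := by ring
  have hlin : (ν / m + 2 * s) * |u m| ≤ (2 * ν / ε + 2) * K * (s * (B * h)) := by
    calc (ν / m + 2 * s) * |u m| = (ν * (1 / m) + 2 * s) * |u m| := by ring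
      _ ≤ (ν * (2 * s / ε) + 2 * s) * (K * B * h) := by
          gcongr
          exact hb m hm le_rfl
      _ = _ := by ring
  rw [add_mul]
  exact hwave.trans (add_le_add hterm hlin)

lemma exists_turning_index {s ε : ℝ} (hs : 0 < s) (hs1 : s ≤ 1) (hε : 0 < ε) (hε1 : ε ≤ 1) :
    ∃ m : ℕ, 1 ≤ m ∧ ε / 2 ≤ m * s ∧ m * s ≤ 1 ∧ ((m : ℝ) - 1) * s ≤ ε := by
  refine ⟨max 1 ⌊ε / s⌋₊, le_max_left _ _, ?_, ?_, ?_⟩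
  · have h1 : ε / s < ⌊ε / s⌋₊ + 1 := Nat.lt_floor_add_one _
    have h2 : (1 : ℝ) ≤ (max 1 ⌊ε / s⌋₊ : ℕ) := by exact_mod_cast le_max_left _ _
    have h3 : (⌊ε / s⌋₊ : ℝ) ≤ (max 1 ⌊ε / s⌋₊ : ℕ) := by exact_mod_cast le_max_right _ _
    rw [div_lt_iff₀ hs] at h1
    nlinarith
  all_goals
    have h4 : (⌊ε / s⌋₊ : ℝ) * s ≤ ε := by
      rw [← le_div_iff₀ hs]
      exact Nat.floor_le (by positivity)
    rcases max_choice 1 ⌊ε / s⌋₊ with h | h <;> rw [h] <;> push_cast <;> linarith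

lemma exists_ultraRecurrence_decay (hν : 1 / 2 < ν) :
    ∃ D : ℝ, 0 < D ∧ ∀ (x : ℝ) (u : ℕ → ℝ) (B : ℝ),
      x ∈ Set.Icc (0 : ℝ) 1 → UltraRecurrence ν x u → |u 1| ≤ B → |u 2| ≤ B →
      ∀ n : ℕ, 1 ≤ n → |u n| * (√(1 - x ^ 2) * n + 1) ^ ν ≤ D * B * ultraDominant ν n := by
  have hν0 : 0 < ν := by linarith
  obtain ⟨ε, K, hε, hε1, hK, hinner⟩ := exists_bound_before_turning hν
  obtain ⟨c, C₁, hc, hC₁, hbounds⟩ := exists_ultraDominant_bounds hν0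
  have hA : 0 < ultraDominant ν 1 + ultraDominant ν 2 :=
    add_pos (ultraDominant_pos hν0 1) (ultraDominant_pos hν0 2)
  obtain ⟨L, hL⟩ : ∃ L, L = Real.exp (|ν * (ν - 1)|) *
      ((ultraDominant ν 1 + ultraDominant ν 2) * (2 / (c ^ 2 * ε)) + 2 * K) +
        (2 * ν / ε + 2) * K := ⟨_, rfl⟩
  have hL0 : 0 < L := by rw [hL]; positivity
  set E := Real.exp (2 * |ν * (ν - 1)| / ε) with hE
  refine ⟨2 ^ ν * (K + E * L * (C₁ / c)), by positivity, ?_⟩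
  intro x u B hx hu h1 h2 n hn
  have hB : 0 ≤ B := (abs_nonneg _).trans h1
  have hn1 : (1 : ℝ) ≤ n := by exact_mod_cast hn
  have hd := ultraDominant_pos hν0
  have hdn := hd n
  have hx2 : 0 ≤ 1 - x ^ 2 := by nlinarith [hx.1, hx.2]
  have hsle : √(1 - x ^ 2) ≤ 1 := Real.sqrt_le_one.2 (by nlinarith [sq_nonneg x])
  have hin := hinner x u B hx hu h1 h2
  have hs0 : 0 ≤ √(1 - x ^ 2) := Real.sqrt_nonneg _
  have hsmall : ((n : ℝ) - 1) * √(1 - x ^ 2) ≤ ε → n * √(1 - x ^ 2) ≤ 1 →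
      |u n| * (√(1 - x ^ 2) * n + 1) ^ ν ≤
        2 ^ ν * (K + E * L * (C₁ / c)) * B * ultraDominant ν n := fun hle hle1 => by
    have hrest : 0 ≤ E * L * (C₁ / c) := by positivity
    calc |u n| * (√(1 - x ^ 2) * n + 1) ^ ν ≤ (K * B * ultraDominant ν n) * 2 ^ ν := by
          gcongr
          · exact hin n hn hle
          · linarith
      _ = 2 ^ ν * K * B * ultraDominant ν n := by ring
      _ ≤ _ := by
          gcongr
          linarith
  rcases hs0.eq_or_lt with hs | hs
  · refine hsmall ?_ ?_ <;> rw [← hs] <;> linarith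
  obtain ⟨m, hm, hlow, hup, hmε⟩ := exists_turning_index hs hsle hε hε1
  have hm0 : (0 : ℝ) < m := by exact_mod_cast hm
  rcases lt_or_ge n m with hnm | hmn
  · have hnm' : (n : ℝ) ≤ m := by exact_mod_cast hnm.le
    exact hsmall (le_trans (by gcongr) hmε) (le_trans (by gcongr) hup)
  have hmn' : (m : ℝ) ≤ n := by exact_mod_cast hmn
  have hw := norm_ultraWave_le_of_bounds hν hx hu h1 h2 hK hε hc hm (hbounds m hm).1 hlow hup
    fun j hj hjm => hin j hj (le_trans (by gcongr) hmε)
  rw [← hL] at hw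
  have hprop := norm_ultraWave_le hν0 hs hu hm hmn
  have hexp : Real.exp (|ν * (ν - 1)| / (√(1 - x ^ 2) * m)) ≤ E := by
    rw [hE, Real.exp_le_exp, div_le_div_iff₀ (by positivity) hε]
    nlinarith [abs_nonneg (ν * (ν - 1))]
  have hun : |u n| ≤ E * L * B * ultraDominant ν m := by
    refine le_of_mul_le_mul_left ?_ hs
    calc √(1 - x ^ 2) * |u n| ≤ ‖ultraWave x u n‖ := sqrt_mul_abs_le_norm_ultraWave n
      _ ≤ E * (L * (√(1 - x ^ 2) * (B * ultraDominant ν m))) :=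
          hprop.trans (mul_le_mul hexp hw (norm_nonneg _) (Real.exp_pos _).le)
      _ = _ := by ring
  have hgrow : ultraDominant ν m * (√(1 - x ^ 2) * n + 1) ^ ν ≤
      2 ^ ν * (C₁ / c) * ultraDominant ν n := by
    have hn0 : (0 : ℝ) ≤ n := by linarith
    calc ultraDominant ν m * (√(1 - x ^ 2) * n + 1) ^ ν
        ≤ C₁ * (m : ℝ) ^ ν * (√(1 - x ^ 2) * n + 1) ^ ν := by
          gcongr
          exact (hbounds m hm).2
      _ = C₁ * ((m : ℝ) * (√(1 - x ^ 2) * n + 1)) ^ ν := by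
          rw [Real.mul_rpow hm0.le (by positivity)]
          ring
      _ ≤ C₁ * (2 * (n : ℝ)) ^ ν := by
          have hle : (m : ℝ) * (√(1 - x ^ 2) * n + 1) ≤ 2 * n := by
            nlinarith [mul_le_mul_of_nonneg_right hup hn0]
          refine mul_le_mul_of_nonneg_left ?_ hC₁.le
          exact Real.rpow_le_rpow (by positivity) hle hν0.le
      _ = 2 ^ ν * (C₁ / c) * (c * (n : ℝ) ^ ν) := by
          rw [Real.mul_rpow two_pos.le hn0]
          field_simp
      _ ≤ _ := by
          gcongr
          exact (hbounds n hn).1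
  calc |u n| * (√(1 - x ^ 2) * n + 1) ^ ν
      ≤ E * L * B * ultraDominant ν m * (√(1 - x ^ 2) * n + 1) ^ ν := by gcongr
    _ = E * L * B * (ultraDominant ν m * (√(1 - x ^ 2) * n + 1) ^ ν) := by ring
    _ ≤ E * L * B * (2 ^ ν * (C₁ / c) * ultraDominant ν n) := by gcongr
    _ = 2 ^ ν * (0 + E * L * (C₁ / c)) * B * ultraDominant ν n := by ring
    _ ≤ _ := by gcongr

end Recurrence

section Codilated

variable {ν lam : ℝ}

lemma ultraPstar_two_eval (x : ℝ) :
    (ultraPstar ν lam 2).eval x = x ^ 2 - lam * ultraBeta ν 1 := by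
  simp [ultraPstar, sq]

lemma ultraPstar_one_eval (x : ℝ) : (ultraPstar ν lam 1).eval x = x := by
  simp [ultraPstar]

lemma ultraPstar_succ_succ_eval (x : ℝ) {k : ℕ} (hk : 1 ≤ k) :
    (ultraPstar ν lam (k + 2)).eval x =
      x * (ultraPstar ν lam (k + 1)).eval x - ultraBeta ν (k + 1) * (ultraPstar ν lam k).eval x := by
  have : k ≠ 0 := by omega
  simp [ultraPstar, this]

lemma ultraRecurrence_ultraPstar (x : ℝ) :
    UltraRecurrence ν x fun n => 2 ^ n * (ultraPstar ν lam n).eval x := fun k hk => by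
  simp only [ultraPstar_succ_succ_eval x hk]
  ring

lemma abs_ultraPstar_eval_neg (x : ℝ) (n : ℕ) :
    |(ultraPstar ν lam n).eval (-x)| = |(ultraPstar ν lam n).eval x| := by
  have key : ∀ n, (ultraPstar ν lam n).eval (-x) = (-1) ^ n * (ultraPstar ν lam n).eval x ∧
      (ultraPstar ν lam (n + 1)).eval (-x) =
        (-1) ^ (n + 1) * (ultraPstar ν lam (n + 1)).eval x := by
    intro n
    induction n with
    | zero => simp [ultraPstar]
    | succ n ih =>
      refine ⟨ih.2, ?_⟩
      simp only [ultraPstar, Polynomial.eval_sub, Polynomial.eval_mul, Polynomial.eval_X,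
        Polynomial.eval_C]
      rw [ih.1, ih.2]
      ring
  rw [(key n).1, abs_mul, abs_pow, abs_neg, abs_one, one_pow, one_mul]

lemma ultraBeta_one (hν : 0 < ν) : ultraBeta ν 1 = 1 / (2 * (1 + ν)) := by
  have h : ((1 : ℕ) : ℝ) + ν - 1 = ν := by simp
  rw [ultraBeta, h]
  push_cast
  field_simp
  ring

lemma ultraPstar_eval_one_eq (hν : 0 < ν) {n : ℕ} (hn : 1 ≤ n) :
    (2 * ν - 1) * (2 ^ n * (ultraPstar ν lam n).eval 1) =
      (2 * ν - lam) * ultraDominant ν n + 2 * ν * (lam - 1) * ultraMinimal ν n := by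
  have key : ∀ n, 1 ≤ n →
      (2 * ν - 1) * (2 ^ n * (ultraPstar ν lam n).eval 1) =
        (2 * ν - lam) * ultraDominant ν n + 2 * ν * (lam - 1) * ultraMinimal ν n ∧
      (2 * ν - 1) * (2 ^ (n + 1) * (ultraPstar ν lam (n + 1)).eval 1) =
        (2 * ν - lam) * ultraDominant ν (n + 1) +
          2 * ν * (lam - 1) * ultraMinimal ν (n + 1) := by
    intro n hn
    induction n, hn using Nat.le_induction with
    | base =>
      rw [ultraPstar_one_eval, ultraPstar_two_eval, ultraBeta_one hν]
      simp only [ultraDominant, ultraMinimal, Finset.prod_range_succ, Finset.prod_range_zero]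
      push_cast
      constructor <;> field_simp <;> ring
    | succ n hn ih =>
      refine ⟨ih.2, ?_⟩
      have hrec := ultraRecurrence_ultraPstar (ν := ν) (lam := lam) 1 n hn
      simp only at hrec
      rw [hrec, ultraDominant_recurrence hν n, ultraMinimal_recurrence hν n]
      linear_combination 2 * ih.2 - 4 * ultraBeta ν (n + 1) * ih.1
  exact (key n hn).1

lemma ultraDominant_le_ultraPstar_eval_one (hν : 1 / 2 < ν) (hlam : lam < 2 * ν) {n : ℕ}
    (hn : 2 ≤ n) :
    (2 * ν - lam) * ultraDominant ν n ≤
      (2 * ν + 1) * (2 ^ n * (ultraPstar ν lam n).eval 1) := by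
  have hν0 : 0 < ν := by linarith
  have heq := ultraPstar_eval_one_eq (lam := lam) hν0 (show 1 ≤ n by omega)
  have hd := ultraDominant_pos hν0 n
  have hg := ultraMinimal_pos hν0 n
  have hcmp := ultraMinimal_le_ultraDominant hν hn
  have h0 : 0 < 2 * ν - 1 := by linarith
  refine le_of_mul_le_mul_left ?_ h0
  rw [mul_left_comm (2 * ν - 1) (2 * ν + 1), heq]
  rcases le_total 1 lam with hl | hl
  · have h1 : 0 ≤ ν * (lam - 1) * ultraMinimal ν n :=
      mul_nonneg (mul_nonneg hν0.le (by linarith)) hg.le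
    nlinarith [mul_pos (sub_pos.2 hlam) hd]
  · have h2 : 0 ≤ (1 - lam) * (ultraDominant ν n - ν * (2 * ν + 1) * ultraMinimal ν n) :=
      mul_nonneg (by linarith) (by linarith)
    nlinarith [mul_pos h0 hd]

lemma ultraPstar_eval_one_pos (hν : 1 / 2 < ν) (hlam : lam < 2 * ν) {n : ℕ} (hn : 1 ≤ n) :
    0 < (ultraPstar ν lam n).eval 1 := by
  rcases hn.eq_or_lt with rfl | hn
  · rw [ultraPstar_one_eval]
    exact one_pos
  · have h := (mul_pos (sub_pos.2 hlam) (ultraDominant_pos (by linarith) n)).trans_le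
      (ultraDominant_le_ultraPstar_eval_one hν hlam hn)
    have h1 := pos_of_mul_pos_right h (by linarith)
    exact pos_of_mul_pos_right h1 (by positivity)

lemma one_le_mul_weight (hν : 1 / 2 < ν) (hlam : lam < 2 * ν) :
    1 ≤ 2 * ν * ((1 + |lam|) / (2 * ν - lam)) := by
  rw [← mul_div_assoc, one_le_div (by linarith)]
  nlinarith [neg_abs_le lam, abs_nonneg lam]

end Codilated

theorem codilated_ultraspherical_decay (ν : ℝ) (hν : 1 / 2 < ν) :
    ∃ C : ℝ, 0 < C ∧ ∀ lam : ℝ, lam < 2 * ν → ∀ n : ℕ, 1 ≤ n →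
      ∀ x ∈ Set.Icc (-1 : ℝ) 1,
        0 < (ultraPstar ν lam n).eval 1 ∧
        |(ultraPstar ν lam n).eval x| ≤
          (1 + |lam|) / (2 * ν - lam) * (C / (Real.sqrt (1 - x ^ 2) * n + 1) ^ ν) *
            (ultraPstar ν lam n).eval 1 := by
  have hν0 : 0 < ν := by linarith
  obtain ⟨D, hD, hdecay⟩ := exists_ultraRecurrence_decay hν
  refine ⟨4 * D * (2 * ν + 1) + 2 * ν * 2 ^ ν, by positivity, ?_⟩
  intro lam hlam n hn x hx
  have hpos := ultraPstar_eval_one_pos hν hlam hn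
  refine ⟨hpos, ?_⟩
  have habs : |(ultraPstar ν lam n).eval x| = |(ultraPstar ν lam n).eval (abs x)| := by
    rcases abs_choice x with h | h <;> rw [h]
    exact (abs_ultraPstar_eval_neg x n).symm
  have hy : |x| ∈ Set.Icc (0 : ℝ) 1 := ⟨abs_nonneg x, abs_le.2 hx⟩
  rw [habs, ← sq_abs x]
  generalize |x| = y at hy
  have hs0 : 0 ≤ √(1 - y ^ 2) := Real.sqrt_nonneg _
  have hs1 : √(1 - y ^ 2) ≤ 1 := Real.sqrt_le_one.2 (by nlinarith [sq_nonneg y])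
  have hw0 : 0 < (1 + |lam|) / (2 * ν - lam) := div_pos (by positivity) (sub_pos.2 hlam)
  have hbase : 0 < (√(1 - y ^ 2) * n + 1) ^ ν := by positivity
  rw [mul_div_assoc', div_mul_eq_mul_div, le_div_iff₀ hbase]
  rcases hn.eq_or_lt with rfl | hn2
  · rw [ultraPstar_one_eval, ultraPstar_one_eval, abs_of_nonneg hy.1]
    have h1 := one_le_mul_weight hν hlam
    have h2 : (√(1 - y ^ 2) * (1 : ℕ) + 1) ^ ν ≤ (2 : ℝ) ^ ν := by
      gcongr
      push_cast
      linarith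
    calc y * (√(1 - y ^ 2) * (1 : ℕ) + 1) ^ ν ≤ 1 * 2 ^ ν := by
          gcongr
          exact hy.2
      _ ≤ 2 * ν * ((1 + |lam|) / (2 * ν - lam)) * 2 ^ ν := by gcongr
      _ = (1 + |lam|) / (2 * ν - lam) * (0 + 2 * ν * 2 ^ ν) * 1 := by ring
      _ ≤ _ := by
          gcongr
          positivity
  · have hu1 : |2 ^ 1 * (ultraPstar ν lam 1).eval y| ≤ 4 * (1 + |lam|) := by
      rw [ultraPstar_one_eval, abs_of_nonneg (by linarith [hy.1])]
      linarith [hy.2, abs_nonneg lam]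
    have hu2 : |2 ^ 2 * (ultraPstar ν lam 2).eval y| ≤ 4 * (1 + |lam|) := by
      have hβ : |lam * ultraBeta ν 1| ≤ |lam| := by
        rw [abs_mul, ultraBeta_one hν0,
          abs_of_pos (by positivity : 0 < 1 / (2 * (1 + ν)))]
        refine mul_le_of_le_one_right (abs_nonneg _) ?_
        rw [div_le_one (by positivity)]
        linarith
      have hy2 : |y ^ 2| ≤ 1 := by
        rw [abs_of_nonneg (sq_nonneg y)]
        exact pow_le_one₀ hy.1 hy.2
      rw [ultraPstar_two_eval, abs_mul]
      norm_num
      linarith [abs_sub (y ^ 2) (lam * ultraBeta ν 1)]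
    have h1 := hdecay y _ _ hy (ultraRecurrence_ultraPstar y) hu1 hu2 n hn
    have h2 := ultraDominant_le_ultraPstar_eval_one hν hlam hn2
    rw [← le_div_iff₀' (sub_pos.2 hlam)] at h2
    rw [abs_mul, abs_of_pos (by positivity : (0 : ℝ) < 2 ^ n), mul_assoc] at h1
    refine le_of_mul_le_mul_left (h1.trans ?_) (by positivity : (0 : ℝ) < 2 ^ n)
    calc D * (4 * (1 + |lam|)) * ultraDominant ν n
        ≤ D * (4 * (1 + |lam|)) *
          ((2 * ν + 1) * (2 ^ n * (ultraPstar ν lam n).eval 1) / (2 * ν - lam)) := by gcongr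
      _ = 2 ^ n * ((1 + |lam|) / (2 * ν - lam) * (4 * D * (2 * ν + 1) + 0) *
            (ultraPstar ν lam n).eval 1) := by ring
      _ ≤ _ := by
          gcongr
          positivity

end
end

section
/- For every real ν > 1/2 there exists a constant C > 0 such that for all real λ < 2ν, all integers n ≥ 1 and all y ∈ [0,1]: P^{(ν)*}_{2n}(1, λ) > 0 and the asymmetric residual polynomial ᵃr*_n(y) := P^{(ν)*}_{2n}(√(1−y), λ)/P^{(ν)*}_{2n}(1, λ) (√ the nonnegative square root) satisfies |ᵃr*_n(y)| ≤ ((1+|λ|)/(2ν−λ)) · C/(2√y·n + 1)^ν; consequently sup_{y∈[0,1]} y^{ν/2}·|ᵃr*_n(y)| ≤ ((1+|λ|)/(2ν−λ)) · C/(2n)^ν. -/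
open Polynomial Filter MeasureTheory

noncomputable section

/-- The asymmetric residual polynomial
`ᵃr*_n(y) = P^{(ν)*}_{2n}(√(1−y), λ)/P^{(ν)*}_{2n}(1, λ)`. -/
def asymResidual (ν lam : ℝ) (n : ℕ) (y : ℝ) : ℝ :=
  (ultraPstar ν lam (2 * n)).eval (Real.sqrt (1 - y)) / (ultraPstar ν lam (2 * n)).eval 1

/-- The normalisation `2 ^ k * P_k(1)` of the ultraspherical polynomials. -/
def ultraNorm (ν : ℝ) : ℕ → ℝ
  | 0 => 1
  | (k + 1) => (2 * ν + k) / (ν + k) * ultraNorm ν k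

/-- The increments `k! / (2ν+1)_k` of the second solution of the normalised ultraspherical
recurrence at the point `1`. -/
def ultraIncr (ν : ℝ) : ℕ → ℝ
  | 0 => 1
  | (k + 1) => (k + 1) / (k + 1 + 2 * ν) * ultraIncr ν k

/-- The ultraspherical recurrence in the normalisation where `1` is a solution at `x = 1`. -/
def IsUltraRec (ν x : ℝ) (w : ℕ → ℝ) : Prop :=
  ∀ k : ℕ, (k + 1 + 2 * ν) * w (k + 2) = 2 * x * (k + 1 + ν) * w (k + 1) - (k + 1) * w k

/-- The co-dilated polynomials at `x`, divided by the values of the ultraspherical polynomials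
at `1`; the value at `0` is `lam`, which makes the unmodified recurrence hold from the start. -/
def codilatedSeq (ν lam x : ℝ) : ℕ → ℝ
  | 0 => lam
  | (k + 1) => 2 ^ (k + 1) * (ultraPstar ν lam (k + 1)).eval x / ultraNorm ν (k + 1)

section UltraNorm

variable {ν : ℝ}

lemma ultraNorm_pos (hν : 1 / 2 < ν) (k : ℕ) : 0 < ultraNorm ν k := by
  induction k with
  | zero => simp [ultraNorm]
  | succ k ih => rw [ultraNorm]; positivity

lemma ultraIncr_pos (hν : 1 / 2 < ν) (k : ℕ) : 0 < ultraIncr ν k := by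
  induction k with
  | zero => simp [ultraIncr]
  | succ k ih => rw [ultraIncr]; positivity

lemma ultraIncr_le (hν : 1 / 2 < ν) (k : ℕ) : (k + 1) * ultraIncr ν k ≤ 1 := by
  induction k with
  | zero => simp [ultraIncr]
  | succ k ih =>
    have h0 := ultraIncr_pos hν k
    have hk : (0 : ℝ) ≤ k := k.cast_nonneg
    have : ((k : ℝ) + 1 + 1) / (k + 1 + 2 * ν) ≤ 1 := by
      rw [div_le_one (by positivity)]; linarith
    rw [ultraIncr]
    push_cast
    calc ((k : ℝ) + 1 + 1) * ((k + 1) / (k + 1 + 2 * ν) * ultraIncr ν k)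
        = (k + 1 + 1) / (k + 1 + 2 * ν) * ((k + 1) * ultraIncr ν k) := by ring
      _ ≤ 1 * ((k + 1) * ultraIncr ν k) := by gcongr
      _ ≤ 1 := by linarith

lemma sum_ultraIncr (hν : 1 / 2 < ν) (k : ℕ) :
    (2 * ν - 1) * ∑ j ∈ Finset.range (k + 1), ultraIncr ν j = 2 * ν - (k + 1) * ultraIncr ν k := by
  induction k with
  | zero => simp [ultraIncr]
  | succ k ih =>
    rw [Finset.sum_range_succ, mul_add, ih, ultraIncr]
    have hk : (k : ℝ) + 1 + 2 * ν ≠ 0 := by positivity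
    push_cast
    field_simp
    ring

lemma sum_ultraIncr_le (hν : 1 / 2 < ν) (k : ℕ) :
    ∑ j ∈ Finset.range k, ultraIncr ν j ≤ 2 * ν / (2 * ν - 1) := by
  have h := sum_ultraIncr hν k
  have h0 := ultraIncr_pos hν k
  have hs : ∑ j ∈ Finset.range k, ultraIncr ν j ≤ ∑ j ∈ Finset.range (k + 1), ultraIncr ν j := by
    rw [Finset.sum_range_succ]; linarith
  have : 0 ≤ ((k : ℝ) + 1) * ultraIncr ν k := by positivity
  rw [le_div_iff₀ (by linarith)]
  nlinarith

lemma ultraNorm_div_le (hν : 1 / 2 < ν) {m k : ℕ} (h : m ≤ k) :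
    ultraNorm ν m / ultraNorm ν k ≤ ((m + 2 * ν) / (k + 2 * ν)) ^ ν := by
  induction k, h using Nat.le_induction with
  | base =>
    have : (m : ℝ) + 2 * ν ≠ 0 := by positivity
    rw [div_self (ultraNorm_pos hν m).ne', div_self this, Real.one_rpow]
  | succ k hk ih =>
    have hg := ultraNorm_pos hν k
    have hgm := ultraNorm_pos hν m
    have hpos : (0 : ℝ) < k + 2 * ν := by positivity
    have step : (ν + k) / (2 * ν + k) ≤ ((k + 2 * ν) / (k + 1 + 2 * ν)) ^ ν := by
      have h1 : (ν + k) / (2 * ν + k) ≤ Real.exp (-(ν / (k + 2 * ν))) := by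
        have := Real.add_one_le_exp (-(ν / (k + 2 * ν)))
        convert this using 1
        field_simp
        ring
      refine h1.trans ?_
      rw [Real.rpow_def_of_pos (by positivity)]
      refine Real.exp_le_exp.2 ?_
      have h2 := Real.log_le_sub_one_of_pos
        (show (0 : ℝ) < (k + 1 + 2 * ν) / (k + 2 * ν) by positivity)
      rw [← inv_div ((k : ℝ) + 1 + 2 * ν), Real.log_inv]
      have h3 : ((k : ℝ) + 1 + 2 * ν) / (k + 2 * ν) - 1 = 1 / (k + 2 * ν) := by
        field_simp; ring
      rw [h3] at h2
      have := mul_le_mul_of_nonneg_right h2 (show 0 ≤ ν by linarith)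
      have h4 : 1 / (k + 2 * ν) * ν = ν / (k + 2 * ν) := by ring
      linarith
    calc ultraNorm ν m / ultraNorm ν (k + 1)
        = ultraNorm ν m / ultraNorm ν k * ((ν + k) / (2 * ν + k)) := by
          rw [ultraNorm]; field_simp
      _ ≤ ((m + 2 * ν) / (k + 2 * ν)) ^ ν * ((k + 2 * ν) / (k + 1 + 2 * ν)) ^ ν := by
          gcongr
      _ = ((m + 2 * ν) / ((k + 1 : ℕ) + 2 * ν)) ^ ν := by
          rw [← Real.mul_rpow (by positivity) (by positivity)]
          push_cast
          congr 1
          field_simp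

end UltraNorm

namespace IsUltraRec

variable {ν x : ℝ} {w : ℕ → ℝ}

lemma diff_eq (h : IsUltraRec ν x w) (k : ℕ) :
    (k + 1 + 2 * ν) * (w (k + 2) - w (k + 1)) =
      (k + 1) * (w (k + 1) - w k) - 2 * (1 - x) * (k + 1 + ν) * w (k + 1) := by
  linear_combination h k

/-- If the sequence is bounded up to `k`, its increment at `k` is bounded. -/
lemma abs_diff_le (h : IsUltraRec ν x w) (hν : 1 / 2 < ν) (hx : x ≤ 1) {W : ℝ} (k : ℕ)
    (hW : ∀ j ≤ k, |w j| ≤ W) :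
    |w (k + 1) - w k| ≤ |w 1 - w 0| * ultraIncr ν k + 2 * (1 - x) * W * (k + 1) := by
  have hW0 : 0 ≤ W := (abs_nonneg _).trans (hW 0 (Nat.zero_le _))
  have hx0 : 0 ≤ 1 - x := by linarith
  induction k with
  | zero =>
    simp only [ultraIncr]
    have : 0 ≤ 2 * (1 - x) * W * ((0 : ℕ) + 1) := by positivity
    simpa using this
  | succ k ih =>
    have ih := ih fun j hj => hW j (by omega)
    have hw := hW (k + 1) le_rfl
    have hpos : (0 : ℝ) < k + 1 + 2 * ν := by positivity
    have hc : 0 ≤ 2 * (1 - x) * (k + 1 + ν) := by positivity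
    refine le_of_mul_le_mul_left ?_ hpos
    calc (k + 1 + 2 * ν) * |w (k + 1 + 1) - w (k + 1)|
        = |(k + 1) * (w (k + 1) - w k) - 2 * (1 - x) * (k + 1 + ν) * w (k + 1)| := by
          rw [← h.diff_eq k, abs_mul, abs_of_pos hpos]
      _ ≤ |(k + 1) * (w (k + 1) - w k)| + |2 * (1 - x) * (k + 1 + ν) * w (k + 1)| := abs_sub _ _
      _ = (k + 1) * |w (k + 1) - w k| + 2 * (1 - x) * (k + 1 + ν) * |w (k + 1)| := by
          rw [abs_mul, abs_mul, abs_of_nonneg hc, abs_of_nonneg (by positivity : (0 : ℝ) ≤ k + 1)]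
      _ ≤ (k + 1) * (|w 1 - w 0| * ultraIncr ν k + 2 * (1 - x) * W * (k + 1)) +
            2 * (1 - x) * (k + 1 + ν) * W := by gcongr
      _ ≤ (k + 1 + 2 * ν) * (|w 1 - w 0| * ((k + 1) / (k + 1 + 2 * ν) * ultraIncr ν k) +
            2 * (1 - x) * W * (k + 1 + 1)) := by
          have e : (k + 1 + 2 * ν) * (|w 1 - w 0| * ((k + 1) / (k + 1 + 2 * ν) * ultraIncr ν k)) =
              (k + 1) * (|w 1 - w 0| * ultraIncr ν k) := by field_simp
          rw [mul_add (k + 1 + 2 * ν), e]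
          have : 0 ≤ (1 - x) * W * ν := by positivity
          have : 0 ≤ (1 - x) * W * ν * k := by positivity
          nlinarith
      _ = _ := by rw [ultraIncr]; push_cast; ring

/-- The bound that holds as long as `k * √(1 - x)` stays small. -/
lemma abs_le_of_small (h : IsUltraRec ν x w) (hν : 1 / 2 < ν) (hx : x ≤ 1) {W : ℝ} (m : ℕ)
    (hm : (1 - x) * (m * (m + 1)) ≤ 1 / 2)
    (hW : 2 * (|w 0| + |w 1 - w 0| * (2 * ν / (2 * ν - 1))) ≤ W) :
    ∀ k ≤ m, |w k| ≤ W := by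
  have hx0 : 0 ≤ 1 - x := by linarith
  have hν' : 0 ≤ 2 * ν / (2 * ν - 1) := div_nonneg (by linarith) (by linarith)
  have hW0 : 0 ≤ W := le_trans (by positivity) hW
  intro k
  induction k using Nat.strong_induction_on with
  | _ k ih =>
  intro hk
  have hsum : w k = w 0 + ∑ j ∈ Finset.range k, (w (j + 1) - w j) := by
    rw [Finset.sum_range_sub]; ring
  have hkm : (k : ℝ) ≤ m := by exact_mod_cast hk
  have gauss : ∀ n : ℕ, ∑ j ∈ Finset.range n, 2 * (1 - x) * W * ((j : ℝ) + 1) =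
      (1 - x) * (n * (n + 1)) * W := by
    intro n
    induction n with
    | zero => simp
    | succ n ihn => rw [Finset.sum_range_succ, ihn]; push_cast; ring
  calc |w k| ≤ |w 0| + ∑ j ∈ Finset.range k, |w (j + 1) - w j| := by
        rw [hsum]
        exact (abs_add_le _ _).trans (add_le_add_right (Finset.abs_sum_le_sum_abs _ _) _)
    _ ≤ |w 0| + ∑ j ∈ Finset.range k,
          (|w 1 - w 0| * ultraIncr ν j + 2 * (1 - x) * W * ((j : ℝ) + 1)) := by
        gcongr with j hj
        rw [Finset.mem_range] at hj
        exact h.abs_diff_le hν hx j fun i hi => ih i (by omega) (by omega)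
    _ = |w 0| + |w 1 - w 0| * ∑ j ∈ Finset.range k, ultraIncr ν j +
          (1 - x) * (k * (k + 1)) * W := by
        rw [Finset.sum_add_distrib, gauss, Finset.mul_sum]; ring
    _ ≤ |w 0| + |w 1 - w 0| * (2 * ν / (2 * ν - 1)) + (1 - x) * (m * (m + 1)) * W := by
        gcongr
        exact sum_ultraIncr_le hν k
    _ ≤ W := by nlinarith

end IsUltraRec

/-- The energy of a two-term window under an `ε`-perturbation of the Chebyshev recurrence. -/
lemma perturbed_chebyshev_energy_le {x s ε R p q : ℝ} (hs : 0 < s) (hsx : s ^ 2 = 1 - x ^ 2)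
    (hR : 0 ≤ R) (h : (q - x * p) ^ 2 + s ^ 2 * p ^ 2 ≤ R ^ 2) :
    ((2 * x * q - (1 - ε) * p) - x * q) ^ 2 + s ^ 2 * q ^ 2 ≤ (R * (1 + |ε| / s)) ^ 2 := by
  have hsym : (x * q - p) ^ 2 + s ^ 2 * q ^ 2 = (q - x * p) ^ 2 + s ^ 2 * p ^ 2 := by
    rw [hsx]; ring
  have h1 : |x * q - p| ≤ R := abs_le_of_sq_le_sq (by nlinarith [sq_nonneg (s * q)]) hR
  have h2 : |p| ≤ R / s := by
    rw [le_div_iff₀ hs, ← abs_of_pos hs, ← abs_mul]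
    exact abs_le_of_sq_le_sq (by nlinarith [sq_nonneg (q - x * p)]) hR
  have h3 : ε * p * (x * q - p) ≤ |ε| * (R / s) * R := by
    refine (le_abs_self _).trans ?_
    rw [abs_mul, abs_mul]
    gcongr
  have h4 : ε ^ 2 * p ^ 2 ≤ |ε| ^ 2 * (R / s) ^ 2 := by
    rw [← sq_abs ε, ← sq_abs p]
    gcongr
  have e : (R * (1 + |ε| / s)) ^ 2 = R ^ 2 + 2 * (|ε| * (R / s) * R) + |ε| ^ 2 * (R / s) ^ 2 := by
    field_simp; ring
  rw [e]
  nlinarith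

namespace IsUltraRec

variable {ν x : ℝ} {w : ℕ → ℝ}

lemma ultraNorm_mul_rec (h : IsUltraRec ν x w) (hν : 1 / 2 < ν) (k : ℕ) :
    ultraNorm ν (k + 2) * w (k + 2) = 2 * x * (ultraNorm ν (k + 1) * w (k + 1)) -
      (1 - ν * (ν - 1) * (1 / (k + ν) - 1 / (k + 1 + ν))) * (ultraNorm ν k * w k) := by
  have hpos : (0 : ℝ) < k + 1 + 2 * ν := by positivity
  have hw : w (k + 2) =
      (2 * x * (k + 1 + ν) * w (k + 1) - (k + 1) * w k) / (k + 1 + 2 * ν) := by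
    rw [eq_div_iff hpos.ne', ← h k]; ring
  rw [hw, ultraNorm, ultraNorm]
  push_cast
  have h1 : (ν + k) ≠ 0 := by positivity
  have h2 : (ν + (k + 1)) ≠ 0 := by positivity
  have h3 : (k + ν) ≠ 0 := by positivity
  have h4 : (k + 1 + ν) ≠ 0 := by positivity
  field_simp
  ring

/-- Growth of the energy from the index `m` on. -/
lemma energy_le (h : IsUltraRec ν x w) (hν : 1 / 2 < ν) {s R : ℝ} (hs : 0 < s)
    (hsx : s ^ 2 = 1 - x ^ 2) (hR : 0 ≤ R) {m k : ℕ} (hmk : m ≤ k)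
    (hm : (ultraNorm ν (m + 1) * w (m + 1) - x * (ultraNorm ν m * w m)) ^ 2 +
      s ^ 2 * (ultraNorm ν m * w m) ^ 2 ≤ R ^ 2) :
    (ultraNorm ν (k + 1) * w (k + 1) - x * (ultraNorm ν k * w k)) ^ 2 +
      s ^ 2 * (ultraNorm ν k * w k) ^ 2 ≤
      (R * Real.exp (ν * |ν - 1| / s * (1 / (m + ν) - 1 / (k + ν)))) ^ 2 := by
  induction k, hmk using Nat.le_induction with
  | base => simpa using hm
  | succ k hk ih =>
    have hstep := perturbed_chebyshev_energy_le
      (ε := ν * (ν - 1) * (1 / (k + ν) - 1 / (k + 1 + ν))) hs hsx (by positivity) ih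
    rw [← h.ultraNorm_mul_rec hν k] at hstep
    refine hstep.trans ?_
    have hd : 0 ≤ 1 / (k + ν) - 1 / (k + 1 + ν) := by
      rw [sub_nonneg]
      exact one_div_le_one_div_of_le (by positivity) (by linarith)
    have habs : |ν * (ν - 1) * (1 / (k + ν) - 1 / (k + 1 + ν))| / s =
        ν * |ν - 1| / s * (1 / (k + ν) - 1 / (k + 1 + ν)) := by
      rw [abs_mul, abs_mul, abs_of_nonneg hd, abs_of_pos (by linarith : 0 < ν)]; ring
    rw [habs, mul_assoc]
    gcongr ?_ ^ 2
    gcongr ?_ * ?_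
    calc _ ≤ Real.exp (ν * |ν - 1| / s * (1 / (m + ν) - 1 / (k + ν))) *
          Real.exp (ν * |ν - 1| / s * (1 / (k + ν) - 1 / (k + 1 + ν))) := by
          gcongr
          rw [add_comm]
          exact Real.add_one_le_exp _
      _ = _ := by
          rw [← Real.exp_add]
          push_cast
          congr 1
          ring

/-- The energy at an index comparable to `1 / s`. -/
lemma initial_energy_le (h : IsUltraRec ν x w) (hν : 1 / 2 < ν) (hx0 : 0 ≤ x) (hx : x ≤ 1)
    {s W : ℝ} (hs : 0 < s) (hsx : s ^ 2 = 1 - x ^ 2) {m : ℕ} (hm : s * (m + 1) ≤ 4 / 3)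
    (hD : 2 * |w 1 - w 0| ≤ W) (hW : ∀ k ≤ m, |w k| ≤ W) :
    (ultraNorm ν (m + 1) * w (m + 1) - x * (ultraNorm ν m * w m)) ^ 2 +
      s ^ 2 * (ultraNorm ν m * w m) ^ 2 ≤
      ((14 + 2 * ν) * W * ultraNorm ν m / (m + 1)) ^ 2 := by
  have hW0 : 0 ≤ W := (abs_nonneg _).trans (hW 0 (Nat.zero_le _))
  have hg := ultraNorm_pos hν m
  have hm0 : (0 : ℝ) < m + 1 := by positivity
  have hxs : 1 - x ≤ s ^ 2 := by rw [hsx]; nlinarith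
  have hs2 : s ^ 2 * (m + 1) ≤ 2 / (m + 1) := by
    rw [le_div_iff₀ hm0]
    nlinarith [mul_pos hs hm0]
  have hs2' : s ^ 2 ≤ 2 / (m + 1) := by
    refine le_trans ?_ hs2
    nlinarith [sq_nonneg s, (m.cast_nonneg : (0 : ℝ) ≤ m)]
  have hs1 : s ≤ 2 / (m + 1) := by rw [le_div_iff₀ hm0]; linarith
  have hdiff : |w (m + 1) - w m| ≤ 5 * W / (m + 1) := by
    have hi : ultraIncr ν m ≤ 1 / (m + 1) := by
      rw [le_div_iff₀ hm0]; linarith [ultraIncr_le hν m]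
    calc _ ≤ |w 1 - w 0| * ultraIncr ν m + 2 * (1 - x) * W * (m + 1) :=
          h.abs_diff_le hν hx m hW
      _ ≤ (W / 2) * (1 / (m + 1)) + 2 * W * (s ^ 2 * (m + 1)) := by
          have h1 : |w 1 - w 0| ≤ W / 2 := by linarith
          have h2 : 2 * (1 - x) * W * (m + 1) ≤ 2 * s ^ 2 * W * (m + 1) := by gcongr
          have h3 : |w 1 - w 0| * ultraIncr ν m ≤ (W / 2) * (1 / (m + 1)) :=
            mul_le_mul h1 hi (ultraIncr_pos hν m).le (by linarith)
          linarith
      _ ≤ (W / 2) * (1 / (m + 1)) + 2 * W * (2 / (m + 1)) := by gcongr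
      _ = (9 / 2) * W / (m + 1) := by ring
      _ ≤ 5 * W / (m + 1) := by gcongr; norm_num
  have hg1 : ultraNorm ν (m + 1) = ultraNorm ν m + ν / (ν + m) * ultraNorm ν m := by
    rw [ultraNorm]; field_simp; ring
  have hg2 : ultraNorm ν (m + 1) ≤ 2 * ultraNorm ν m := by
    have : ν / (ν + m) ≤ 1 := by
      rw [div_le_one (by positivity)]; linarith [(m.cast_nonneg : (0 : ℝ) ≤ m)]
    rw [hg1]; nlinarith
  have hνm : ν / (ν + m) ≤ 2 * ν / (m + 1) := by
    rw [div_le_div_iff₀ (by positivity) hm0]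
    nlinarith [(m.cast_nonneg : (0 : ℝ) ≤ m)]
  have hwm := hW m le_rfl
  have hA : |ultraNorm ν (m + 1) * w (m + 1) - x * (ultraNorm ν m * w m)| ≤
      (12 + 2 * ν) * (W * ultraNorm ν m / (m + 1)) := by
    have hpos1 : 0 ≤ ν / (ν + m) * ultraNorm ν m := by positivity
    have hpos2 : 0 ≤ (1 - x) * ultraNorm ν m := mul_nonneg (by linarith) hg.le
    have hG := ultraNorm_pos hν (m + 1)
    have e : ultraNorm ν (m + 1) * w (m + 1) - x * (ultraNorm ν m * w m) =
        ultraNorm ν (m + 1) * (w (m + 1) - w m) + (ν / (ν + m) * ultraNorm ν m) * w m +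
          ((1 - x) * ultraNorm ν m) * w m := by
      linear_combination w m * hg1
    rw [e]
    calc _ ≤ |ultraNorm ν (m + 1) * (w (m + 1) - w m)| + |(ν / (ν + m) * ultraNorm ν m) * w m| +
          |((1 - x) * ultraNorm ν m) * w m| := abs_add_three _ _ _
      _ = ultraNorm ν (m + 1) * |w (m + 1) - w m| + (ν / (ν + m) * ultraNorm ν m) * |w m| +
          ((1 - x) * ultraNorm ν m) * |w m| := by
          rw [abs_mul, abs_mul _ (w m), abs_mul _ (w m), abs_of_pos hG, abs_of_nonneg hpos1,
            abs_of_nonneg hpos2]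
      _ ≤ 2 * ultraNorm ν m * (5 * W / (m + 1)) + (2 * ν / (m + 1) * ultraNorm ν m) * W +
          (2 / (m + 1) * ultraNorm ν m) * W := by
          have := hxs.trans hs2'
          gcongr
      _ = _ := by ring
  have hB : |s * (ultraNorm ν m * w m)| ≤ 2 * (W * ultraNorm ν m / (m + 1)) := by
    rw [abs_mul, abs_mul, abs_of_pos hs, abs_of_pos hg]
    calc _ ≤ 2 / (m + 1) * (ultraNorm ν m * W) := by gcongr
      _ = _ := by ring
  have hY : 0 ≤ W * ultraNorm ν m / (m + 1) := by positivity
  have e : (14 + 2 * ν) * W * ultraNorm ν m / (m + 1) =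
      (12 + 2 * ν) * (W * ultraNorm ν m / (m + 1)) + 2 * (W * ultraNorm ν m / (m + 1)) := by ring
  rw [e, ← sq_abs (ultraNorm ν (m + 1) * _ - _), ← mul_pow, ← sq_abs (s * _)]
  have := pow_le_pow_left₀ (abs_nonneg _) hA 2
  have := pow_le_pow_left₀ (abs_nonneg _) hB 2
  have : 0 ≤ ((12 + 2 * ν) * (W * ultraNorm ν m / (m + 1))) * (2 * (W * ultraNorm ν m / (m + 1))) :=
    by positivity
  nlinarith

/-- Solutions of the normalised ultraspherical recurrence decay like `(k s + 1) ^ (-ν)`. -/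
theorem abs_le (h : IsUltraRec ν x w) (hν : 1 / 2 < ν) (hx0 : 0 ≤ x) (hx : x ≤ 1)
    {s W : ℝ} (hs : 0 ≤ s) (hsx : s ^ 2 = 1 - x ^ 2)
    (hW : 2 * (|w 0| + |w 1 - w 0| * (2 * ν / (2 * ν - 1))) ≤ W) (k : ℕ) :
    |w k| ≤ 3 * (14 + 2 * ν) * Real.exp (6 * (ν * |ν - 1|)) * (16 * ν) ^ ν * W /
      (k * s + 1) ^ ν := by
  have hν' : 1 ≤ 2 * ν / (2 * ν - 1) := by
    rw [le_div_iff₀ (by linarith)]; linarith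
  have hD : 2 * |w 1 - w 0| ≤ W := by
    nlinarith [abs_nonneg (w 1 - w 0), abs_nonneg (w 0)]
  have hW0 : 0 ≤ W := le_trans (by positivity) hD
  have hexp : 1 ≤ Real.exp (6 * (ν * |ν - 1|)) := Real.one_le_exp (by positivity)
  have hC : 1 ≤ 3 * (14 + 2 * ν) * Real.exp (6 * (ν * |ν - 1|)) := by
    nlinarith
  have hxs : 1 - x ≤ s ^ 2 := by rw [hsx]; nlinarith
  have hs1 : s ≤ 1 := by nlinarith
  have small : (k : ℝ) * s ≤ 1 / 3 → |w k| ≤ W := by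
    intro hks
    refine h.abs_le_of_small hν hx k ?_ hW k le_rfl
    calc (1 - x) * (k * (k + 1)) ≤ s ^ 2 * (k * (k + 1)) := by gcongr
      _ = (k * s) * (k * s + s) := by ring
      _ ≤ (1 / 3) * (1 / 3 + 1) := by gcongr
      _ ≤ 1 / 2 := by norm_num
  by_cases hks : (k : ℝ) * s ≤ 1 / 3
  · have hpow : (k * s + 1) ^ ν ≤ (16 * ν) ^ ν := by
      gcongr
      linarith
    rw [le_div_iff₀ (by positivity)]
    calc |w k| * (k * s + 1) ^ ν ≤ W * (16 * ν) ^ ν := by gcongr; exact small hks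
      _ ≤ 3 * (14 + 2 * ν) * Real.exp (6 * (ν * |ν - 1|)) * (W * (16 * ν) ^ ν) :=
          le_mul_of_one_le_left (by positivity) hC
      _ = _ := by ring
  have hks' : 1 / 3 < (k : ℝ) * s := not_le.1 hks
  have hs0 : 0 < s := by
    rcases hs.eq_or_lt with h0 | h0
    · rw [← h0] at hks'; norm_num at hks'
    · exact h0
  set m := ⌊1 / (3 * s)⌋₊ with hm
  have hm1 : (m : ℝ) * s ≤ 1 / 3 := by
    have := Nat.floor_le (show 0 ≤ 1 / (3 * s) by positivity)
    rw [← hm, le_div_iff₀ (by positivity)] at this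
    linarith
  have hm2 : 1 / 3 < (m + 1) * s := by
    have := Nat.lt_floor_add_one (1 / (3 * s))
    rw [← hm, div_lt_iff₀ (by positivity)] at this
    linarith
  have hmk : m ≤ k := by
    have : (m : ℝ) ≤ k := le_of_mul_le_mul_right (hm1.trans hks'.le) hs0
    exact_mod_cast this
  have hmW : ∀ j ≤ m, |w j| ≤ W := by
    refine h.abs_le_of_small hν hx m ?_ hW
    calc (1 - x) * (m * (m + 1)) ≤ s ^ 2 * (m * (m + 1)) := by gcongr
      _ = (m * s) * (m * s + s) := by ring
      _ ≤ (1 / 3) * (1 / 3 + 1) := by gcongr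
      _ ≤ 1 / 2 := by norm_num
  have hgm := ultraNorm_pos hν m
  have hgk := ultraNorm_pos hν k
  have hm0 : (0 : ℝ) < m + 1 := by positivity
  have hE := h.energy_le hν hs0 hsx (by positivity) hmk
    (h.initial_energy_le hν hx0 hx hs0 hsx (by linarith) hD hmW)
  have hexp' : Real.exp (ν * |ν - 1| / s * (1 / (m + ν) - 1 / (k + ν))) ≤
      Real.exp (6 * (ν * |ν - 1|)) := by
    refine Real.exp_le_exp.2 ?_
    have h1 : 1 / (s * (m + ν)) ≤ 6 := by
      rw [div_le_iff₀ (by positivity)]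
      nlinarith [(m.cast_nonneg : (0 : ℝ) ≤ m)]
    have h2 : 0 ≤ ν * |ν - 1| / s * (1 / (k + ν)) := by positivity
    calc _ ≤ ν * |ν - 1| / s * (1 / (m + ν)) := by rw [mul_sub]; linarith
      _ = ν * |ν - 1| * (1 / (s * (m + ν))) := by field_simp
      _ ≤ ν * |ν - 1| * 6 := by gcongr
      _ = _ := by ring
  have hp : s * (ultraNorm ν k * |w k|) ≤
      (14 + 2 * ν) * W * ultraNorm ν m / (m + 1) * Real.exp (6 * (ν * |ν - 1|)) := by
    have h1 : |s * (ultraNorm ν k * w k)| ≤ (14 + 2 * ν) * W * ultraNorm ν m / (m + 1) *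
        Real.exp (ν * |ν - 1| / s * (1 / (m + ν) - 1 / (k + ν))) := by
      refine abs_le_of_sq_le_sq ?_ (by positivity)
      rw [mul_pow]
      nlinarith [sq_nonneg (ultraNorm ν (k + 1) * w (k + 1) - x * (ultraNorm ν k * w k))]
    rw [abs_mul, abs_mul, abs_of_pos hs0, abs_of_pos hgk] at h1
    refine h1.trans ?_
    gcongr
  have hratio : ultraNorm ν m / ultraNorm ν k ≤ (16 * ν) ^ ν / (k * s + 1) ^ ν := by
    rw [← Real.div_rpow (by positivity) (by positivity)]
    refine (ultraNorm_div_le hν hmk).trans ?_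
    gcongr ?_ ^ ν
    rw [div_le_div_iff₀ (by positivity) (by positivity)]
    have a1 : (k : ℝ) * s + 1 ≤ 4 * (k * s) := by linarith
    have a2 : (m + 2 * ν) * s ≤ 4 * ν := by nlinarith
    calc (m + 2 * ν) * (k * s + 1) ≤ (m + 2 * ν) * (4 * (k * s)) := by gcongr
      _ = (m + 2 * ν) * s * (4 * k) := by ring
      _ ≤ 4 * ν * (4 * k) := by gcongr
      _ ≤ 16 * ν * (k + 2 * ν) := by nlinarith
  have h3 : 1 / (s * (m + 1)) ≤ 3 := by
    rw [div_le_iff₀ (by positivity)]; linarith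
  calc |w k| = s * (ultraNorm ν k * |w k|) / (s * ultraNorm ν k) := by field_simp
    _ ≤ (14 + 2 * ν) * W * ultraNorm ν m / (m + 1) * Real.exp (6 * (ν * |ν - 1|)) /
          (s * ultraNorm ν k) := by gcongr
    _ = 1 / (s * (m + 1)) * ((14 + 2 * ν) * Real.exp (6 * (ν * |ν - 1|)) * W) *
          (ultraNorm ν m / ultraNorm ν k) := by field_simp
    _ ≤ 3 * ((14 + 2 * ν) * Real.exp (6 * (ν * |ν - 1|)) * W) *
          ((16 * ν) ^ ν / (k * s + 1) ^ ν) := by gcongr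
    _ = _ := by ring

/-- At `x = 1` a solution is determined by its initial increment. -/
lemma eq_of_one (h : IsUltraRec ν 1 w) (hν : 1 / 2 < ν) (k : ℕ) :
    w k = w 0 + (w 1 - w 0) * ∑ j ∈ Finset.range k, ultraIncr ν j := by
  have hd : ∀ k, w (k + 1) - w k = (w 1 - w 0) * ultraIncr ν k := by
    intro k
    induction k with
    | zero => simp [ultraIncr]
    | succ k ih =>
      have := h.diff_eq k
      have hpos : (0 : ℝ) < k + 1 + 2 * ν := by positivity
      rw [ih] at this
      rw [ultraIncr]
      refine mul_left_cancel₀ hpos.ne' ?_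
      rw [this]
      field_simp
      ring
  have hsum : w k = w 0 + ∑ j ∈ Finset.range k, (w (j + 1) - w j) := by
    rw [Finset.sum_range_sub]; ring
  rw [hsum, Finset.mul_sum]
  exact congrArg _ (Finset.sum_congr rfl fun j _ => hd j)

end IsUltraRec

section Codilated

variable {ν : ℝ}

lemma isUltraRec_codilatedSeq (hν : 1 / 2 < ν) (lam x : ℝ) :
    IsUltraRec ν x (codilatedSeq ν lam x) := by
  intro k
  have hν0 : ν ≠ 0 := by positivity
  cases k with
  | zero =>
    have h1 : ν + 1 ≠ 0 := by positivity
    have h2 : 2 * ν + 1 ≠ 0 := by positivity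
    have h3 : 1 + ν ≠ 0 := by positivity
    simp only [codilatedSeq, ultraPstar, ultraNorm, ultraBeta]
    norm_num
    field_simp
    ring
  | succ k =>
    have hg := (ultraNorm_pos hν (k + 1)).ne'
    have h1 : ν + (k + 1) ≠ 0 := by positivity
    have h2 : ν + (k + 1 + 1) ≠ 0 := by positivity
    have h3 : 2 * ν + (k + 1) ≠ 0 := by positivity
    have h4 : 2 * ν + (k + 1 + 1) ≠ 0 := by positivity
    have h5 : k + 1 + 1 + ν ≠ 0 := by positivity
    have h6 : k + 1 + 1 + ν - 1 ≠ 0 := by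
      have : (k : ℝ) + 1 + 1 + ν - 1 = k + 1 + ν := by ring
      rw [this]; positivity
    have hP : (ultraPstar ν lam (k + 1 + 2)).eval x =
        x * (ultraPstar ν lam (k + 1 + 1)).eval x -
          ultraBeta ν (k + 1 + 1) * (ultraPstar ν lam (k + 1)).eval x := by
      rw [ultraPstar, if_neg (by omega)]
      simp
    simp only [codilatedSeq]
    rw [show k + 1 + 1 + 1 = k + 1 + 2 from rfl, hP,
      show ultraNorm ν (k + 1 + 2) = (2 * ν + (k + 1 + 1 : ℕ)) / (ν + (k + 1 + 1 : ℕ)) *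
        ((2 * ν + (k + 1 : ℕ)) / (ν + (k + 1 : ℕ)) * ultraNorm ν (k + 1)) from rfl,
      show ultraNorm ν (k + 1 + 1) = (2 * ν + (k + 1 : ℕ)) / (ν + (k + 1 : ℕ)) *
        ultraNorm ν (k + 1) from rfl, ultraBeta]
    generalize (ultraPstar ν lam (k + 1 + 1)).eval x = a
    generalize (ultraPstar ν lam (k + 1)).eval x = b
    generalize ultraNorm ν (k + 1) = g at *
    push_cast
    field_simp
    ring

lemma codilatedSeq_one (hν : 1 / 2 < ν) (lam x : ℝ) : codilatedSeq ν lam x 1 = x := by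
  have hν0 : ν ≠ 0 := by positivity
  simp [codilatedSeq, ultraPstar, ultraNorm]
  field_simp

lemma eval_ultraPstar_eq (hν : 1 / 2 < ν) (lam x : ℝ) {k : ℕ} (hk : 1 ≤ k) :
    (ultraPstar ν lam k).eval x = ultraNorm ν k / 2 ^ k * codilatedSeq ν lam x k := by
  obtain ⟨k, rfl⟩ := Nat.exists_eq_add_of_le' hk
  have := (ultraNorm_pos hν (k + 1)).ne'
  rw [codilatedSeq]
  field_simp

lemma le_codilatedSeq_at_one (hν : 1 / 2 < ν) {lam : ℝ} (hlam : lam < 2 * ν) {k : ℕ}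
    (hk : 2 ≤ k) : (2 * ν - lam) / (2 * ν + 1) ≤ codilatedSeq ν lam 1 k := by
  have hrec := (isUltraRec_codilatedSeq hν lam 1).eq_of_one hν k
  rw [codilatedSeq_one hν, show codilatedSeq ν lam 1 0 = lam from rfl] at hrec
  have hup := sum_ultraIncr_le hν k
  have hlow : 1 + 1 / (1 + 2 * ν) ≤ ∑ j ∈ Finset.range k, ultraIncr ν j := by
    calc 1 + 1 / (1 + 2 * ν) = ∑ j ∈ Finset.range 2, ultraIncr ν j := by
          simp [Finset.sum_range_succ, ultraIncr]
      _ ≤ _ := Finset.sum_le_sum_of_subset_of_nonneg (by simpa using hk)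
          fun j _ _ => (ultraIncr_pos hν j).le
  rw [hrec]
  generalize ∑ j ∈ Finset.range k, ultraIncr ν j = H at *
  rw [le_div_iff₀ (by linarith)] at hup
  have e : (2 * ν - lam) / (2 * ν + 1) = (2 * ν - lam) * (1 / (1 + 2 * ν)) := by
    rw [add_comm]; ring
  rw [e]
  nlinarith

lemma asymResidual_eq (hν : 1 / 2 < ν) (lam y : ℝ) {n : ℕ} (hn : 1 ≤ n) :
    asymResidual ν lam n y =
      codilatedSeq ν lam (Real.sqrt (1 - y)) (2 * n) / codilatedSeq ν lam 1 (2 * n) := by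
  have := ultraNorm_pos hν (2 * n)
  rw [asymResidual, eval_ultraPstar_eq hν _ _ (by omega), eval_ultraPstar_eq hν _ _ (by omega),
    mul_div_mul_left _ _ (by positivity)]

end Codilated

theorem codilated_nu_method_convergence (ν : ℝ) (hν : 1 / 2 < ν) :
    ∃ C : ℝ, 0 < C ∧ ∀ lam : ℝ, lam < 2 * ν → ∀ n : ℕ, 1 ≤ n →
      0 < (ultraPstar ν lam (2 * n)).eval 1 ∧
      (∀ y ∈ Set.Icc (0 : ℝ) 1,
        |asymResidual ν lam n y| ≤
          (1 + |lam|) / (2 * ν - lam) * (C / (2 * Real.sqrt y * n + 1) ^ ν)) ∧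
      (∀ y ∈ Set.Icc (0 : ℝ) 1,
        y ^ (ν / 2) * |asymResidual ν lam n y| ≤
          (1 + |lam|) / (2 * ν - lam) * (C / (2 * n : ℝ) ^ ν)) := by
  have hν1 : 0 < 2 * ν - 1 := by linarith
  set B := 3 * (14 + 2 * ν) * Real.exp (6 * (ν * |ν - 1|)) * (16 * ν) ^ ν with hB
  have hBpos : 0 < B := by positivity
  set A := 2 * (1 + 2 * ν / (2 * ν - 1)) with hA
  have hApos : 0 < A := by positivity
  refine ⟨(2 * ν + 1) * (B * A), by positivity, fun lam hlam n hn => ?_⟩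
  have hl : 0 < 2 * ν - lam := by linarith
  have hlow := le_codilatedSeq_at_one hν hlam (show 2 ≤ 2 * n by omega)
  have hlow0 : 0 < (2 * ν - lam) / (2 * ν + 1) := by positivity
  have key : ∀ y ∈ Set.Icc (0 : ℝ) 1, |asymResidual ν lam n y| ≤
      (1 + |lam|) / (2 * ν - lam) *
        ((2 * ν + 1) * (B * A) / (2 * Real.sqrt y * n + 1) ^ ν) := by
    rintro y ⟨hy0, hy1⟩
    have hx1 : Real.sqrt (1 - y) ≤ 1 := Real.sqrt_le_one.2 (by linarith)
    have hsx : Real.sqrt y ^ 2 = 1 - Real.sqrt (1 - y) ^ 2 := by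
      rw [Real.sq_sqrt hy0, Real.sq_sqrt (by linarith)]; ring
    have hW : 2 * (|codilatedSeq ν lam (Real.sqrt (1 - y)) 0| +
        |codilatedSeq ν lam (Real.sqrt (1 - y)) 1 - codilatedSeq ν lam (Real.sqrt (1 - y)) 0| *
          (2 * ν / (2 * ν - 1))) ≤ A * (1 + |lam|) := by
      rw [codilatedSeq_one hν, show codilatedSeq ν lam (Real.sqrt (1 - y)) 0 = lam from rfl]
      have h1 : |Real.sqrt (1 - y) - lam| ≤ 1 + |lam| := by
        refine (abs_sub _ _).trans ?_
        rw [abs_of_nonneg (Real.sqrt_nonneg _)]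
        linarith
      have h2 : 0 < 2 * ν / (2 * ν - 1) := by positivity
      rw [hA]
      nlinarith
    have hbound := (isUltraRec_codilatedSeq hν lam _).abs_le hν (Real.sqrt_nonneg _) hx1
      (Real.sqrt_nonneg y) hsx hW (2 * n)
    rw [← hB] at hbound
    rw [asymResidual_eq hν lam y hn, abs_div, abs_of_pos (hlow0.trans_le hlow)]
    have hbase : ((2 * n : ℕ) : ℝ) * Real.sqrt y + 1 = 2 * Real.sqrt y * n + 1 := by
      push_cast; ring
    rw [hbase] at hbound
    calc _ ≤ B * (A * (1 + |lam|)) / (2 * Real.sqrt y * n + 1) ^ ν /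
          ((2 * ν - lam) / (2 * ν + 1)) := by gcongr
      _ = _ := by field_simp
  refine ⟨?_, key, fun y hy => ?_⟩
  · rw [eval_ultraPstar_eq hν _ _ (by omega)]
    have := ultraNorm_pos hν (2 * n)
    have := hlow0.trans_le hlow
    positivity
  · have hn0 : (0 : ℝ) < n := by exact_mod_cast hn
    have hy : y ^ (ν / 2) = Real.sqrt y ^ ν := by
      rw [Real.sqrt_eq_rpow, ← Real.rpow_mul hy.1]
      congr 1
      ring
    have hpow : Real.sqrt y ^ ν * (2 * n : ℝ) ^ ν ≤ (2 * Real.sqrt y * n + 1) ^ ν := by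
      rw [← Real.mul_rpow (Real.sqrt_nonneg _) (by positivity)]
      gcongr
      linarith
    have hfrac : Real.sqrt y ^ ν / (2 * Real.sqrt y * n + 1) ^ ν ≤ 1 / (2 * n : ℝ) ^ ν := by
      rw [div_le_div_iff₀ (by positivity) (by positivity)]
      linarith
    calc y ^ (ν / 2) * |asymResidual ν lam n y|
        ≤ Real.sqrt y ^ ν * ((1 + |lam|) / (2 * ν - lam) *
          ((2 * ν + 1) * (B * A) / (2 * Real.sqrt y * n + 1) ^ ν)) := by
          rw [hy]
          gcongr
          exact key y ‹_›
      _ = (1 + |lam|) / (2 * ν - lam) * ((2 * ν + 1) * (B * A) *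
          (Real.sqrt y ^ ν / (2 * Real.sqrt y * n + 1) ^ ν)) := by ring
      _ ≤ (1 + |lam|) / (2 * ν - lam) * ((2 * ν + 1) * (B * A) * (1 / (2 * n : ℝ) ^ ν)) := by
          gcongr
      _ = _ := by ring

end
end
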